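/- arXiv:2605.31573 — 15 statements merged into one kernel-verified Lean document; each statement's English description precedes it below -/
import Mathlib

section
/- For every discount factor α ∈ [0,1) and every n ∈ ℕ, the functions i ↦ V_{α,n}(i,0) and i ↦ V_{α,n}(i,1) are nondecreasing in i and convex in i (i.e. V_{α,n}(i+1,q) − V_{α,n}(i,q) ≥ V_{α,n}(i,q) − V_{α,n}((i−1)⁺,q) for all i ∈ ℕ and q ∈ {0,1}). Consequently the value-iteration policies are of threshold form: for every n and every i ≥ 1, if V_{α,n}(i,1) − V_{α,n}(i−1,1) ≤ c2/((1−α)(μ2−μ1)) then also V_{α,n}(j,1) − V_{α,n}(j−1,1) ≤ c2/((1−α)(μ2−μ1)) for every j with 1 ≤ j ≤ i. -/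
/-- Value iteration for the uniformised M/M/1 queue with a temporary control period.
`VI lam mu1 mu2 beta c2 cmu mu α h n i q` is `V_{α,n}(i,q)`, where `q = false` is the
state without control and `q = true` the state with control; `i - 1` is `ℕ`-subtraction,
i.e. `(i-1)⁺`. -/
noncomputable def VI (lam mu1 mu2 beta c2 cmu mu α : ℝ) (h : ℕ → ℝ) : ℕ → ℕ → Bool → ℝ
  | 0, _, _ => 0
  | n+1, i, false =>
      cmu + h i + (1 - α) * (mu * VI lam mu1 mu2 beta c2 cmu mu α h n (i - 1) false
        + (1 - lam - mu) * VI lam mu1 mu2 beta c2 cmu mu α h n i false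
        + lam * VI lam mu1 mu2 beta c2 cmu mu α h n (i + 1) false)
  | n+1, i, true =>
      h i + (1 - α) * (mu1 * VI lam mu1 mu2 beta c2 cmu mu α h n i true
        + mu1 * VI lam mu1 mu2 beta c2 cmu mu α h n (i - 1) true
        + lam * VI lam mu1 mu2 beta c2 cmu mu α h n (i + 1) true
        + beta * VI lam mu1 mu2 beta c2 cmu mu α h n i false)
      + min ((1 - α) * (mu2 - mu1) * VI lam mu1 mu2 beta c2 cmu mu α h n i true)
            (c2 + (1 - α) * (mu2 - mu1) * VI lam mu1 mu2 beta c2 cmu mu α h n (i - 1) true)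

/-- A nondecreasing convex sequence, with the convention `f (-1) = f 0`. -/
structure MonoConvexSeq (f : ℕ → ℝ) : Prop where
  mono : ∀ i, f i ≤ f (i + 1)
  convex : ∀ i, f i - f (i - 1) ≤ f (i + 1) - f i

namespace MonoConvexSeq

variable {f g : ℕ → ℝ}

theorem const (c : ℝ) : MonoConvexSeq fun _ => c :=
  ⟨fun _ => le_rfl, fun _ => le_rfl⟩

theorem add (hf : MonoConvexSeq f) (hg : MonoConvexSeq g) :
    MonoConvexSeq fun i => f i + g i :=
  ⟨fun i => add_le_add (hf.mono i) (hg.mono i),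
    fun i => by linarith [hf.convex i, hg.convex i]⟩

theorem const_mul {c : ℝ} (hc : 0 ≤ c) (hf : MonoConvexSeq f) :
    MonoConvexSeq fun i => c * f i :=
  ⟨fun i => mul_le_mul_of_nonneg_left (hf.mono i) hc,
    fun i => by linarith [mul_le_mul_of_nonneg_left (hf.convex i) hc]⟩

theorem comp_succ (hf : MonoConvexSeq f) : MonoConvexSeq fun i => f (i + 1) := by
  refine ⟨fun i => hf.mono (i + 1), fun i => ?_⟩
  cases i with
  | zero => simpa using hf.mono 1
  | succ k => exact hf.convex (k + 2)

theorem comp_pred (hf : MonoConvexSeq f) : MonoConvexSeq fun i => f (i - 1) := by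
  constructor <;> rintro (_ | k)
  · simp
  · exact hf.mono k
  · simp
  · exact hf.convex k

theorem min_add_pred (c : ℝ) (hf : MonoConvexSeq f) :
    MonoConvexSeq fun i => min (f i) (c + f (i - 1)) := by
  have hmono (i : ℕ) : min (f i) (c + f (i - 1)) ≤ min (f (i + 1)) (c + f (i + 1 - 1)) :=
    min_le_min (hf.mono i) (add_le_add le_rfl (hf.comp_pred.mono i))
  refine ⟨hmono, fun i => ?_⟩
  cases i with
  | zero => simpa using hmono 0
  | succ k =>
    have h₁ := hf.convex k
    have h₂ := hf.convex (k + 1)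
    simp only [Nat.add_sub_cancel] at h₂ ⊢
    have hl := min_le_left (f (k + 1)) (c + f k)
    have hr := min_le_right (f (k + 1)) (c + f k)
    rcases min_choice (f k) (c + f (k - 1)) with h | h <;>
    rcases min_choice (f (k + 1 + 1)) (c + f (k + 1)) with h' | h' <;>
    rw [h, h'] <;> linarith

theorem monotone_diff (hf : MonoConvexSeq f) : Monotone fun i => f i - f (i - 1) :=
  monotone_nat_of_le_succ fun i => hf.convex i

end MonoConvexSeq

theorem monoConvexSeq_VI {lam mu1 mu2 beta c2 cmu mu α : ℝ} {h : ℕ → ℝ}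
    (hlam : 0 ≤ lam) (hmu1 : 0 ≤ mu1) (hmu12 : mu1 ≤ mu2) (hbeta : 0 ≤ beta)
    (hmu : 0 ≤ mu) (hlm : lam + mu ≤ 1) (hα1 : α ≤ 1) (hh : MonoConvexSeq h) (n : ℕ) (q : Bool) :
    MonoConvexSeq fun i => VI lam mu1 mu2 beta c2 cmu mu α h n i q := by
  have hα : 0 ≤ 1 - α := sub_nonneg.2 hα1
  induction n generalizing q with
  | zero => simpa only [VI] using MonoConvexSeq.const 0
  | succ n ih =>
    cases q with
    | false =>
      simp only [VI]
      exact ((MonoConvexSeq.const cmu).add hh).add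
        (((((ih false).comp_pred.const_mul hmu).add
          ((ih false).const_mul (by linarith))).add
          ((ih false).comp_succ.const_mul hlam)).const_mul hα)
    | true =>
      simp only [VI]
      exact (hh.add
        ((((((ih true).const_mul hmu1).add ((ih true).comp_pred.const_mul hmu1)).add
          ((ih true).comp_succ.const_mul hlam)).add
          ((ih false).const_mul hbeta)).const_mul hα)).add
        (((ih true).const_mul (mul_nonneg hα (sub_nonneg.2 hmu12))).min_add_pred c2)

/-- Proposition 1 of the paper: monotonicity and convexity of the value-iteration
value functions, and the threshold form of the value-iteration policies. -/
theorem stmt0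
    (lam mu1 mu2 beta c2 cmu mu : ℝ) (h : ℕ → ℝ)
    (hlam : 0 < lam) (hmu1 : 0 < mu1) (hmu12 : mu1 < mu2) (hbeta : 0 < beta)
    (hsum : lam + mu1 + mu2 + beta = 1) (hc2 : 0 < c2)
    (hmu : (mu = mu1 ∧ cmu = 0) ∨ (mu = mu2 ∧ cmu = c2)) (hstab : lam < mu)
    (hh0 : h 0 = 0) (hhnn : ∀ i : ℕ, 0 ≤ h i) (hhmono : ∀ i : ℕ, h i ≤ h (i + 1))
    (hhconv : ∀ j : ℕ, 1 ≤ j → h j - h (j - 1) ≤ h (j + 1) - h j)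
    (α : ℝ) (hα0 : 0 ≤ α) (hα1 : α < 1) :
    (∀ (n i : ℕ) (q : Bool),
      VI lam mu1 mu2 beta c2 cmu mu α h n i q ≤ VI lam mu1 mu2 beta c2 cmu mu α h n (i + 1) q) ∧
    (∀ (n i : ℕ) (q : Bool),
      VI lam mu1 mu2 beta c2 cmu mu α h n i q - VI lam mu1 mu2 beta c2 cmu mu α h n (i - 1) q ≤
        VI lam mu1 mu2 beta c2 cmu mu α h n (i + 1) q - VI lam mu1 mu2 beta c2 cmu mu α h n i q) ∧
    (∀ (n i : ℕ), 1 ≤ i →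
      VI lam mu1 mu2 beta c2 cmu mu α h n i true - VI lam mu1 mu2 beta c2 cmu mu α h n (i - 1) true ≤
        c2 / ((1 - α) * (mu2 - mu1)) →
      ∀ j : ℕ, 1 ≤ j → j ≤ i →
        VI lam mu1 mu2 beta c2 cmu mu α h n j true - VI lam mu1 mu2 beta c2 cmu mu α h n (j - 1) true ≤
          c2 / ((1 - α) * (mu2 - mu1))) := by
  have hh : MonoConvexSeq h := by
    refine ⟨hhmono, fun i => ?_⟩
    cases i with
    | zero => simpa using hhmono 0
    | succ k => exact hhconv (k + 1) (Nat.le_add_left 1 k)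
  have hlm : lam + mu ≤ 1 := by
    rcases hmu with ⟨rfl, -⟩ | ⟨rfl, -⟩ <;> linarith
  have hV (n : ℕ) (q : Bool) :
      MonoConvexSeq fun i => VI lam mu1 mu2 beta c2 cmu mu α h n i q :=
    monoConvexSeq_VI hlam.le hmu1.le hmu12.le hbeta.le (hlam.trans hstab).le hlm hα1.le hh n q
  exact ⟨fun n i q => (hV n q).mono i, fun n i q => (hV n q).convex i,
    fun n i _ hi j _ hji => ((hV n true).monotone_diff hji).trans hi⟩
end

section
/- For every discount factor α ∈ [0,1), every q ∈ {0,1}, every i ≥ 1 and every n ∈ ℕ, the value-iteration increments are nondecreasing in the iteration index: V_{α,n+1}(i,q) − V_{α,n+1}(i−1,q) ≥ V_{α,n}(i,q) − V_{α,n}(i−1,q). -/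
/-- The increment of `min (a * V(i)) (c + a * V(i - 1))` between consecutive states is a
nondecreasing function of the increments of `V`. -/
theorem min_increment_mono {a c u v w u' v' w' : ℝ} (ha : 0 ≤ a)
    (h1 : u - v ≤ u' - v') (h2 : v - w ≤ v' - w') :
    min (a * u) (c + a * v) - min (a * v) (c + a * w) ≤
      min (a * u') (c + a * v') - min (a * v') (c + a * w') := by
  have e1 := mul_le_mul_of_nonneg_left h1 ha
  have e2 := mul_le_mul_of_nonneg_left h2 ha
  simp only [mul_sub] at e1 e2
  rcases min_cases (a * u) (c + a * v) with ⟨p, p'⟩ | ⟨p, p'⟩ <;>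
  rcases min_cases (a * v) (c + a * w) with ⟨q, q'⟩ | ⟨q, q'⟩ <;>
  rcases min_cases (a * u') (c + a * v') with ⟨r, r'⟩ | ⟨r, r'⟩ <;>
  rcases min_cases (a * v') (c + a * w') with ⟨s, s'⟩ | ⟨s, s'⟩ <;>
  rw [p, q, r, s] <;> linarith

/-- If the increments of the `m`-th iterate dominate those of the `n`-th one, the same holds
after one more iteration. -/
theorem VI_increment_step {lam mu1 mu2 beta c2 cmu mu α : ℝ} {h : ℕ → ℝ}
    (hlam : 0 ≤ lam) (hmu1 : 0 ≤ mu1) (hmu12 : mu1 ≤ mu2) (hbeta : 0 ≤ beta)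
    (hmu : 0 ≤ mu) (hlammu : lam + mu ≤ 1) (hα1 : α ≤ 1) {n m : ℕ}
    (H : ∀ i q, VI lam mu1 mu2 beta c2 cmu mu α h n i q
        - VI lam mu1 mu2 beta c2 cmu mu α h n (i - 1) q ≤
      VI lam mu1 mu2 beta c2 cmu mu α h m i q
        - VI lam mu1 mu2 beta c2 cmu mu α h m (i - 1) q) (i : ℕ) (q : Bool) :
    VI lam mu1 mu2 beta c2 cmu mu α h (n + 1) i q
        - VI lam mu1 mu2 beta c2 cmu mu α h (n + 1) (i - 1) q ≤
      VI lam mu1 mu2 beta c2 cmu mu α h (m + 1) i q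
        - VI lam mu1 mu2 beta c2 cmu mu α h (m + 1) (i - 1) q := by
  rcases i with _ | i
  · simp
  have hα : 0 ≤ 1 - α := by linarith
  have scale : ∀ {k x y : ℝ}, 0 ≤ k → x ≤ y → (1 - α) * (k * x) ≤ (1 - α) * (k * y) :=
    fun hk hxy => mul_le_mul_of_nonneg_left (mul_le_mul_of_nonneg_left hxy hk) hα
  have H0 := H i
  have H1 := H (i + 1)
  have H2 := H (i + 2)
  simp only [Nat.add_sub_cancel, show i + 2 - 1 = i + 1 from rfl] at H1 H2 ⊢
  cases q
  · have e0 := scale hmu (H0 false)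
    have e1 := scale (show 0 ≤ 1 - lam - mu by linarith) (H1 false)
    have e2 := scale hlam (H2 false)
    simp only [VI, Nat.add_sub_cancel, add_assoc, Nat.reduceAdd]
    linarith
  · have e0 := scale hmu1 (H0 true)
    have e1 := scale hmu1 (H1 true)
    have e2 := scale hlam (H2 true)
    have e3 := scale hbeta (H1 false)
    have e4 := min_increment_mono (c := c2) (mul_nonneg hα (sub_nonneg.2 hmu12))
      (H1 true) (H0 true)
    simp only [VI, Nat.add_sub_cancel, add_assoc, Nat.reduceAdd]
    linarith

/-- The value-iteration increments are nondecreasing in the iteration index. -/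
theorem stmt1
    (lam mu1 mu2 beta c2 cmu mu : ℝ) (h : ℕ → ℝ)
    (hlam : 0 < lam) (hmu1 : 0 < mu1) (hmu12 : mu1 < mu2) (hbeta : 0 < beta)
    (hsum : lam + mu1 + mu2 + beta = 1) (hc2 : 0 < c2)
    (hmu : (mu = mu1 ∧ cmu = 0) ∨ (mu = mu2 ∧ cmu = c2)) (hstab : lam < mu)
    (hh0 : h 0 = 0) (hhnn : ∀ i : ℕ, 0 ≤ h i) (hhmono : ∀ i : ℕ, h i ≤ h (i + 1))
    (hhconv : ∀ j : ℕ, 1 ≤ j → h j - h (j - 1) ≤ h (j + 1) - h j)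
    (α : ℝ) (hα0 : 0 ≤ α) (hα1 : α < 1) (q : Bool) (i : ℕ) (hi : 1 ≤ i) (n : ℕ) :
    VI lam mu1 mu2 beta c2 cmu mu α h n i q - VI lam mu1 mu2 beta c2 cmu mu α h n (i - 1) q ≤
      VI lam mu1 mu2 beta c2 cmu mu α h (n + 1) i q - VI lam mu1 mu2 beta c2 cmu mu α h (n + 1) (i - 1) q := by
  have hmu' : 0 ≤ mu := (hlam.trans hstab).le
  have hlammu : lam + mu ≤ 1 := by rcases hmu with ⟨rfl, _⟩ | ⟨rfl, _⟩ <;> linarith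
  clear hi
  induction n generalizing i q with
  | zero =>
    rcases i with _ | i
    · simp
    · cases q <;> simp [VI, hhmono i, hc2.le]
  | succ n ih =>
    exact VI_increment_step hlam.le hmu1.le hmu12.le hbeta.le hmu' hlammu hα1.le
      (fun i q => ih q i) i q
end

section
/- The value-iteration increments are nonincreasing in the discount factor: for all discount factors α, α′ with 0 ≤ α ≤ α′ < 1, every q ∈ {0,1}, every i ≥ 1 and every n ∈ ℕ, V_{α′,n}(i,q) − V_{α′,n}(i−1,q) ≤ V_{α,n}(i,q) − V_{α,n}(i−1,q). -/
/-- The increment of a two-action minimum, written as a monotone function of the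
increments `v - u` and `w - v`. -/
theorem min_sub_min_eq_max_add_min (u v w c : ℝ) :
    min w (c + v) - min v (c + u) = max (v - u - c) 0 + min (w - v) c := by
  grind

theorem VI_false_increment (lam mu1 mu2 beta c2 cmu mu α : ℝ) (h : ℕ → ℝ) (n k : ℕ)
    (V : ℕ → Bool → ℝ) (hV : V = VI lam mu1 mu2 beta c2 cmu mu α h n) :
    VI lam mu1 mu2 beta c2 cmu mu α h (n + 1) (k + 1) false
        - VI lam mu1 mu2 beta c2 cmu mu α h (n + 1) k false =
      h (k + 1) - h k + (mu * ((1 - α) * (V k false - V (k - 1) false))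
        + (1 - lam - mu) * ((1 - α) * (V (k + 1) false - V k false))
        + lam * ((1 - α) * (V (k + 2) false - V (k + 1) false))) := by
  subst hV
  simp only [VI, Nat.add_sub_cancel]
  ring

theorem VI_true_increment (lam mu1 mu2 beta c2 cmu mu α : ℝ) (h : ℕ → ℝ) (n k : ℕ)
    (V : ℕ → Bool → ℝ) (hV : V = VI lam mu1 mu2 beta c2 cmu mu α h n) :
    VI lam mu1 mu2 beta c2 cmu mu α h (n + 1) (k + 1) true
        - VI lam mu1 mu2 beta c2 cmu mu α h (n + 1) k true =
      h (k + 1) - h k + (mu1 * ((1 - α) * (V (k + 1) true - V k true))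
        + mu1 * ((1 - α) * (V k true - V (k - 1) true))
        + lam * ((1 - α) * (V (k + 2) true - V (k + 1) true))
        + beta * ((1 - α) * (V (k + 1) false - V k false)))
        + (max ((mu2 - mu1) * ((1 - α) * (V k true - V (k - 1) true)) - c2) 0
          + min ((mu2 - mu1) * ((1 - α) * (V (k + 1) true - V k true))) c2) := by
  subst hV
  have key := min_sub_min_eq_max_add_min
    ((1 - α) * (mu2 - mu1) * VI lam mu1 mu2 beta c2 cmu mu α h n (k - 1) true)
    ((1 - α) * (mu2 - mu1) * VI lam mu1 mu2 beta c2 cmu mu α h n k true)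
    ((1 - α) * (mu2 - mu1) * VI lam mu1 mu2 beta c2 cmu mu α h n (k + 1) true) c2
  simp only [← mul_sub] at key
  simp only [← mul_assoc, mul_comm (mu2 - mu1) (1 - α)]
  simp only [VI, Nat.add_sub_cancel]
  linear_combination key

/-- Increments of the value iteration are nonnegative and nonincreasing in the discount factor. -/
theorem VI_increment_nonneg_and_antitone
    {lam mu1 mu2 beta c2 cmu mu : ℝ} {h : ℕ → ℝ}
    (hlam : 0 ≤ lam) (hmu1 : 0 ≤ mu1) (hmu12 : mu1 ≤ mu2) (hbeta : 0 ≤ beta) (hc2 : 0 ≤ c2)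
    (hmu : 0 ≤ mu) (hlam_mu : lam + mu ≤ 1) (hh : ∀ i : ℕ, h i ≤ h (i + 1))
    {α α' : ℝ} (hαα' : α ≤ α') (hα' : α' ≤ 1) (n i : ℕ) (q : Bool) :
    0 ≤ VI lam mu1 mu2 beta c2 cmu mu α' h n i q
        - VI lam mu1 mu2 beta c2 cmu mu α' h n (i - 1) q ∧
      VI lam mu1 mu2 beta c2 cmu mu α' h n i q
        - VI lam mu1 mu2 beta c2 cmu mu α' h n (i - 1) q ≤
      VI lam mu1 mu2 beta c2 cmu mu α h n i q
        - VI lam mu1 mu2 beta c2 cmu mu α h n (i - 1) q := by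
  induction n generalizing i q with
  | zero => simp [VI]
  | succ n ih =>
    obtain _ | k := i
    · simp
    have hnn (j : ℕ) (r : Bool) := mul_nonneg (sub_nonneg.2 hα') (ih j r).1
    have hle (j : ℕ) (r : Bool) := mul_le_mul (sub_le_sub_left hαα' 1) (ih j r).2 (ih j r).1
      (sub_nonneg.2 (hαα'.trans hα'))
    have hk := sub_nonneg.2 (hh k)
    have hδ := sub_nonneg.2 hmu12
    have hstay : 0 ≤ 1 - lam - mu := by linarith
    have n0 := hnn k
    have n1 := hnn (k + 1)
    have n2 := hnn (k + 2)
    have l0 := hle k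
    have l1 := hle (k + 1)
    have l2 := hle (k + 2)
    simp only [Nat.add_sub_cancel, show k + 2 - 1 = k + 1 from rfl] at n1 n2 l1 l2 ⊢
    cases q
    · simp only [VI_false_increment _ _ _ _ _ _ _ _ _ _ _ _ rfl]
      constructor
      · have := n0 false
        have := n1 false
        have := n2 false
        positivity
      · gcongr _ + (_ * ?_ + _ * ?_ + _ * ?_)
        exacts [l0 false, l1 false, l2 false]
    · simp only [VI_true_increment _ _ _ _ _ _ _ _ _ _ _ _ rfl]
      constructor
      · have := n0 true
        have := n1 true
        have := n2 true
        have := n1 false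
        have := le_min (mul_nonneg hδ (n1 true)) hc2
        positivity
      · gcongr _ + (_ * ?_ + _ * ?_ + _ * ?_ + _ * ?_) + (max (_ * ?_ - _) _ + min (_ * ?_) _)
        exacts [l1 true, l0 true, l2 true, l1 false, l0 true, l1 true]

/-- The value-iteration increments are nonincreasing in the discount factor. -/
theorem stmt2
    (lam mu1 mu2 beta c2 cmu mu : ℝ) (h : ℕ → ℝ)
    (hlam : 0 < lam) (hmu1 : 0 < mu1) (hmu12 : mu1 < mu2) (hbeta : 0 < beta)
    (hsum : lam + mu1 + mu2 + beta = 1) (hc2 : 0 < c2)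
    (hmu : (mu = mu1 ∧ cmu = 0) ∨ (mu = mu2 ∧ cmu = c2)) (hstab : lam < mu)
    (hh0 : h 0 = 0) (hhnn : ∀ i : ℕ, 0 ≤ h i) (hhmono : ∀ i : ℕ, h i ≤ h (i + 1))
    (hhconv : ∀ j : ℕ, 1 ≤ j → h j - h (j - 1) ≤ h (j + 1) - h j)
    (α α' : ℝ) (hα0 : 0 ≤ α) (hαα' : α ≤ α') (hα'1 : α' < 1)
    (q : Bool) (i : ℕ) (hi : 1 ≤ i) (n : ℕ) :
    VI lam mu1 mu2 beta c2 cmu mu α' h n i q - VI lam mu1 mu2 beta c2 cmu mu α' h n (i - 1) q ≤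
      VI lam mu1 mu2 beta c2 cmu mu α h n i q - VI lam mu1 mu2 beta c2 cmu mu α h n (i - 1) q := by
  have hmu_bounds : 0 ≤ mu ∧ lam + mu ≤ 1 := by
    obtain ⟨rfl, -⟩ | ⟨rfl, -⟩ := hmu <;> constructor <;> linarith
  exact (VI_increment_nonneg_and_antitone hlam.le hmu1.le hmu12.le hbeta.le hc2.le
    hmu_bounds.1 hmu_bounds.2 hhmono hαα' hα'1.le n i q).2
end

section
/- Let α ∈ (0,1) and let i, n ∈ ℕ with i > n. Suppose that for every m < n and every j with 1 ≤ j ≤ i + 2n one has V_{α,m}(j,1) − V_{α,m}(j−1,1) ≤ c2/((1−α)(μ2−μ1)) (i.e. all value-iteration thresholds up to step n are at least i + 2n). Then ((1−(1−α)^n)/α)·(h(i−n+1) − h(i−n)) ≤ V_{α,n}(i,1) − V_{α,n}(i−1,1) ≤ ((1−(1−α)^n)/α)·(h(i+n) − h(i+n−1)). -/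
/-- If every increment entering a Bellman update lies between `A * L` and `A * U`, so does their
weighted average, and the updated increment lies between the bounds scaled by `1 + r * A`. -/
theorem discounted_average_mem_Icc {r A L U d a b c e x y z w : ℝ} (hr : 0 ≤ r)
    (ha : 0 ≤ a) (hb : 0 ≤ b) (hc : 0 ≤ c) (he : 0 ≤ e) (hsum : a + b + c + e = 1)
    (hd : d ∈ Set.Icc L U) (hx : x ∈ Set.Icc (A * L) (A * U)) (hy : y ∈ Set.Icc (A * L) (A * U))
    (hz : z ∈ Set.Icc (A * L) (A * U)) (hw : w ∈ Set.Icc (A * L) (A * U)) :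
    d + r * (a * x + b * y + c * z + e * w) ∈ Set.Icc ((1 + r * A) * L) ((1 + r * A) * U) := by
  have hlo : A * L ≤ a * x + b * y + c * z + e * w := by
    calc A * L = a * (A * L) + b * (A * L) + c * (A * L) + e * (A * L) := by
          linear_combination (-(A * L)) * hsum
      _ ≤ _ := by
          have := hx.1; have := hy.1; have := hz.1; have := hw.1
          gcongr
  have hup : a * x + b * y + c * z + e * w ≤ A * U := by
    calc _ ≤ a * (A * U) + b * (A * U) + c * (A * U) + e * (A * U) := by
          have := hx.2; have := hy.2; have := hz.2; have := hw.2
          gcongr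
      _ = A * U := by linear_combination (A * U) * hsum
  have hlo' := mul_le_mul_of_nonneg_left hlo hr
  have hup' := mul_le_mul_of_nonneg_left hup hr
  constructor
  · linarith [hd.1]
  · linarith [hd.2]

/-- Widening an interval of the form `[A * L, A * U]` with `A` nonnegative. -/
theorem mem_Icc_mul_of_le {A L U L' U' x : ℝ} (hA : 0 ≤ A)
    (hx : x ∈ Set.Icc (A * L) (A * U)) (hL : L' ≤ L) (hU : U ≤ U') :
    x ∈ Set.Icc (A * L') (A * U') :=
  Set.Icc_subset_Icc (mul_le_mul_of_nonneg_left hL hA) (mul_le_mul_of_nonneg_left hU hA) hx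

theorem geom_factor_succ {α : ℝ} (hα : α ≠ 0) (m : ℕ) :
    (1 - (1 - α) ^ (m + 1)) / α = 1 + (1 - α) * ((1 - (1 - α) ^ m) / α) := by
  field_simp
  ring

theorem geom_factor_nonneg {α : ℝ} (hα0 : 0 < α) (hα1 : α < 1) (m : ℕ) :
    0 ≤ (1 - (1 - α) ^ m) / α :=
  div_nonneg (sub_nonneg.2 (pow_le_one₀ (by linarith) (by linarith))) hα0.le

section Increments

variable {lam mu1 mu2 beta c2 cmu mu α : ℝ} {h : ℕ → ℝ}

/-- Increment bounds in the uncontrolled states. -/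
theorem VI_false_increment_mem_Icc
    (hlam : 0 ≤ lam) (hmu : 0 ≤ mu) (hle : lam + mu ≤ 1)
    (hmono : Monotone fun j => h (j + 1) - h j) (hα0 : 0 < α) (hα1 : α < 1) (m k : ℕ) :
    VI lam mu1 mu2 beta c2 cmu mu α h m (m + k + 1) false
        - VI lam mu1 mu2 beta c2 cmu mu α h m (m + k) false ∈
      Set.Icc ((1 - (1 - α) ^ m) / α * (h (k + 1 + 1) - h (k + 1)))
        ((1 - (1 - α) ^ m) / α * (h (2 * m + k + 1) - h (2 * m + k))) := by
  induction m generalizing k with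
  | zero => simp [VI]
  | succ m ih =>
    have hA := geom_factor_nonneg hα0 hα1 m
    have hmid : h (m + 1 + k + 1) - h (m + 1 + k) ∈
        Set.Icc (h (k + 1 + 1) - h (k + 1)) (h (2 * (m + 1) + k + 1) - h (2 * (m + 1) + k)) :=
      ⟨hmono (by lia), hmono (by lia)⟩
    have hwide (l : ℕ) (hl : l ≤ 2) := mem_Icc_mul_of_le hA (ih (k + l))
      (hmono (show k + 1 ≤ k + l + 1 by lia))
      (hmono (show 2 * m + (k + l) ≤ 2 * (m + 1) + k by lia))
    have key := discounted_average_mem_Icc (sub_nonneg.2 hα1.le) hmu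
      (show 0 ≤ 1 - lam - mu by linarith) hlam le_rfl (by ring) hmid
      (hwide 0 (by lia)) (hwide 1 (by lia)) (hwide 2 (by lia)) (hwide 0 (by lia))
    rw [geom_factor_succ hα0.ne']
    convert key using 1
    have hshift : m + 1 + k = m + k + 1 := by lia
    simp only [VI, hshift, Nat.add_sub_cancel, ← add_assoc, add_zero,
      show m + k + 2 - 1 = m + k + 1 from rfl]
    ring

/-- Below the threshold the slow service rate attains the minimum in the Bellman operator. -/
theorem min_eq_left_of_increment_le {r δ c x y : ℝ} (hr : 0 < r) (hδ : 0 < δ)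
    (hxy : x - y ≤ c / (r * δ)) : min (r * δ * x) (c + r * δ * y) = r * δ * x := by
  rw [le_div_iff₀ (mul_pos hr hδ)] at hxy
  exact min_eq_left (by linarith)

/-- Increment bounds in the controlled states below the thresholds. -/
theorem VI_true_increment_mem_Icc
    (hlam : 0 ≤ lam) (hmu1 : 0 ≤ mu1) (hmu12 : mu1 < mu2) (hbeta : 0 ≤ beta)
    (hsum : lam + mu1 + mu2 + beta = 1) (hmu : 0 ≤ mu) (hle : lam + mu ≤ 1)
    (hmono : Monotone fun j => h (j + 1) - h j) (hα0 : 0 < α) (hα1 : α < 1) {n N : ℕ}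
    (hthr : ∀ m < n, ∀ j, 1 ≤ j → j ≤ N →
      VI lam mu1 mu2 beta c2 cmu mu α h m j true - VI lam mu1 mu2 beta c2 cmu mu α h m (j - 1) true ≤
        c2 / ((1 - α) * (mu2 - mu1)))
    (m k : ℕ) (hm : m ≤ n) (hk : 2 * m + k + 1 ≤ N) :
    VI lam mu1 mu2 beta c2 cmu mu α h m (m + k + 1) true
        - VI lam mu1 mu2 beta c2 cmu mu α h m (m + k) true ∈
      Set.Icc ((1 - (1 - α) ^ m) / α * (h (k + 1 + 1) - h (k + 1)))
        ((1 - (1 - α) ^ m) / α * (h (2 * m + k + 1) - h (2 * m + k))) := by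
  induction m generalizing k with
  | zero => simp [VI]
  | succ m ih =>
    have hA := geom_factor_nonneg hα0 hα1 m
    have hmid : h (m + 1 + k + 1) - h (m + 1 + k) ∈
        Set.Icc (h (k + 1 + 1) - h (k + 1)) (h (2 * (m + 1) + k + 1) - h (2 * (m + 1) + k)) :=
      ⟨hmono (by lia), hmono (by lia)⟩
    have hwide (l : ℕ) (hl : l ≤ 2) := mem_Icc_mul_of_le hA (ih (k + l) (by lia) (by lia))
      (hmono (show k + 1 ≤ k + l + 1 by lia))
      (hmono (show 2 * m + (k + l) ≤ 2 * (m + 1) + k by lia))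
    have hfalse := mem_Icc_mul_of_le hA
      (VI_false_increment_mem_Icc (mu1 := mu1) (mu2 := mu2) (beta := beta) (c2 := c2) (cmu := cmu)
        hlam hmu hle hmono hα0 hα1 m (k + 1))
      (hmono (show k + 1 ≤ k + 1 + 1 by lia))
      (hmono (show 2 * m + (k + 1) ≤ 2 * (m + 1) + k by lia))
    have key := discounted_average_mem_Icc (sub_nonneg.2 hα1.le) hmu1 (hmu1.trans hmu12.le)
      hlam hbeta (by linarith) hmid
      (hwide 0 (by lia)) (hwide 1 (by lia)) (hwide 2 (by lia)) hfalse
    have hmin1 := min_eq_left_of_increment_le (sub_pos.2 hα1) (sub_pos.2 hmu12)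
      (hthr m (by lia) (m + k + 1) (by lia) (by lia))
    have hmin2 := min_eq_left_of_increment_le (sub_pos.2 hα1) (sub_pos.2 hmu12)
      (hthr m (by lia) (m + k + 2) (by lia) (by lia))
    rw [geom_factor_succ hα0.ne']
    convert key using 1
    have hshift : m + 1 + k = m + k + 1 := by lia
    simp only [VI, hshift, hmin1, hmin2]
    simp only [Nat.add_sub_cancel, ← add_assoc, add_zero,
      show m + k + 2 - 1 = m + k + 1 from rfl]
    ring

end Increments

/-- Lemma 2 of the paper (discounted case): bounds on value-iteration increments when
all thresholds up to step `n` are at least `i + 2n`. -/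
theorem stmt3
    (lam mu1 mu2 beta c2 cmu mu : ℝ) (h : ℕ → ℝ)
    (hlam : 0 < lam) (hmu1 : 0 < mu1) (hmu12 : mu1 < mu2) (hbeta : 0 < beta)
    (hsum : lam + mu1 + mu2 + beta = 1) (hc2 : 0 < c2)
    (hmu : (mu = mu1 ∧ cmu = 0) ∨ (mu = mu2 ∧ cmu = c2)) (hstab : lam < mu)
    (hh0 : h 0 = 0) (hhnn : ∀ i : ℕ, 0 ≤ h i) (hhmono : ∀ i : ℕ, h i ≤ h (i + 1))
    (hhconv : ∀ j : ℕ, 1 ≤ j → h j - h (j - 1) ≤ h (j + 1) - h j)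
    (α : ℝ) (hα0 : 0 < α) (hα1 : α < 1) (i n : ℕ) (hin : n < i)
    (hthr : ∀ m : ℕ, m < n → ∀ j : ℕ, 1 ≤ j → j ≤ i + 2 * n →
      VI lam mu1 mu2 beta c2 cmu mu α h m j true - VI lam mu1 mu2 beta c2 cmu mu α h m (j - 1) true ≤
        c2 / ((1 - α) * (mu2 - mu1))) :
    ((1 - (1 - α) ^ n) / α) * (h (i - n + 1) - h (i - n)) ≤
        VI lam mu1 mu2 beta c2 cmu mu α h n i true - VI lam mu1 mu2 beta c2 cmu mu α h n (i - 1) true ∧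
      VI lam mu1 mu2 beta c2 cmu mu α h n i true - VI lam mu1 mu2 beta c2 cmu mu α h n (i - 1) true ≤
        ((1 - (1 - α) ^ n) / α) * (h (i + n) - h (i + n - 1)) := by
  have hmono : Monotone fun j => h (j + 1) - h j :=
    monotone_nat_of_le_succ fun j => by simpa using hhconv (j + 1) (by lia)
  have hmu_nonneg : 0 ≤ mu := (hlam.trans hstab).le
  have hle : lam + mu ≤ 1 := by
    rcases hmu with ⟨rfl, -⟩ | ⟨rfl, -⟩ <;> linarith
  obtain ⟨k, rfl⟩ : ∃ k, i = n + k + 1 := ⟨i - n - 1, by lia⟩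
  have key := VI_true_increment_mem_Icc hlam.le hmu1.le hmu12 hbeta.le hsum hmu_nonneg hle
    hmono hα0 hα1 hthr n k le_rfl (by lia)
  rw [show n + k + 1 - n = k + 1 by lia, show n + k + 1 - 1 = n + k by lia,
    show n + k + 1 + n - 1 = 2 * n + k by lia, show n + k + 1 + n = 2 * n + k + 1 by lia]
  exact key
end

section
/- (Non-discounted case, α = 0.) Let i, n ∈ ℕ with i > n. Suppose that for every m < n and every j with 1 ≤ j ≤ i + 2n one has V_{0,m}(j,1) − V_{0,m}(j−1,1) ≤ c2/(μ2−μ1) (i.e. all value-iteration thresholds up to step n are at least i + 2n). Then n·(h(i−n+1) − h(i−n)) ≤ V_{0,n}(i,1) − V_{0,n}(i−1,1) ≤ n·(h(i+n) − h(i+n−1)). -/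
/-- Increments of the uncontrolled value iteration away from the boundary. -/
theorem VI_false_increment_bounds
    (lam mu1 mu2 beta c2 cmu mu : ℝ) (h : ℕ → ℝ)
    (hlam : 0 ≤ lam) (hmu : 0 ≤ mu) (hle : lam + mu ≤ 1)
    (hd : Monotone fun k => h (k + 1) - h k) (m : ℕ) :
    ∀ k : ℕ,
      (m : ℝ) * (h (k + 2) - h (k + 1)) ≤
          VI lam mu1 mu2 beta c2 cmu mu 0 h m (k + m + 1) false
            - VI lam mu1 mu2 beta c2 cmu mu 0 h m (k + m) false ∧
        VI lam mu1 mu2 beta c2 cmu mu 0 h m (k + m + 1) false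
            - VI lam mu1 mu2 beta c2 cmu mu 0 h m (k + m) false ≤
          (m : ℝ) * (h (k + 2 * m + 1) - h (k + 2 * m)) := by
  induction m with
  | zero => intro k; simp [VI]
  | succ m ih =>
    intro k
    have hm : (0 : ℝ) ≤ m := m.cast_nonneg
    obtain ⟨l0, u0⟩ := ih k
    obtain ⟨l1, u1⟩ := ih (k + 1)
    obtain ⟨l2, u2⟩ := ih (k + 2)
    have a1 : h (k + 2) - h (k + 1) ≤ h (k + 3) - h (k + 2) := hd (by omega : k + 1 ≤ k + 2)
    have a2 : h (k + 2) - h (k + 1) ≤ h (k + 4) - h (k + 3) := hd (by omega : k + 1 ≤ k + 3)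
    have a3 : h (k + 2) - h (k + 1) ≤ h (k + m + 2) - h (k + m + 1) :=
      hd (by omega : k + 1 ≤ k + m + 1)
    have b0 : h (k + 2 * m + 1) - h (k + 2 * m) ≤ h (k + 2 * m + 3) - h (k + 2 * m + 2) :=
      hd (by omega : k + 2 * m ≤ k + 2 * m + 2)
    have b1 : h (k + 2 * m + 2) - h (k + 2 * m + 1) ≤ h (k + 2 * m + 3) - h (k + 2 * m + 2) :=
      hd (by omega : k + 2 * m + 1 ≤ k + 2 * m + 2)
    have b3 : h (k + m + 2) - h (k + m + 1) ≤ h (k + 2 * m + 3) - h (k + 2 * m + 2) :=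
      hd (by omega : k + m + 1 ≤ k + 2 * m + 2)
    replace l1 := (mul_le_mul_of_nonneg_left a1 hm).trans l1
    replace l2 := (mul_le_mul_of_nonneg_left a2 hm).trans l2
    rw [show k + 1 + 2 * m + 1 = k + 2 * m + 2 by omega,
      show k + 1 + 2 * m = k + 2 * m + 1 by omega] at u1
    rw [show k + 2 + 2 * m + 1 = k + 2 * m + 3 by omega,
      show k + 2 + 2 * m = k + 2 * m + 2 by omega] at u2
    replace u0 := u0.trans (mul_le_mul_of_nonneg_left b0 hm)
    replace u1 := u1.trans (mul_le_mul_of_nonneg_left b1 hm)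
    rw [show k + 1 + m + 1 = k + m + 2 by omega, show k + 1 + m = k + m + 1 by omega] at l1 u1
    rw [show k + 2 + m + 1 = k + m + 3 by omega, show k + 2 + m = k + m + 2 by omega] at l2 u2
    rw [show k + (m + 1) + 1 = k + m + 2 by omega, show k + (m + 1) = k + m + 1 by omega,
      show k + 2 * (m + 1) + 1 = k + 2 * m + 3 by omega,
      show k + 2 * (m + 1) = k + 2 * m + 2 by omega]
    simp only [VI, show k + m + 2 - 1 = k + m + 1 by omega, show k + m + 1 - 1 = k + m by omega,
      show k + m + 2 + 1 = k + m + 3 by omega, show k + m + 1 + 1 = k + m + 2 by omega]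
    push_cast
    have hr : 0 ≤ 1 - lam - mu := by linarith
    constructor
    · linarith [mul_le_mul_of_nonneg_left l0 hmu, mul_le_mul_of_nonneg_left l1 hr,
        mul_le_mul_of_nonneg_left l2 hlam]
    · linarith [mul_le_mul_of_nonneg_left u0 hmu, mul_le_mul_of_nonneg_left u1 hr,
        mul_le_mul_of_nonneg_left u2 hlam]

/-- Increments of the controlled value iteration away from the boundary, as long as all
thresholds up to step `n` are at least `L`. -/
theorem VI_true_increment_bounds
    (lam mu1 mu2 beta c2 cmu mu : ℝ) (h : ℕ → ℝ)
    (hlam : 0 ≤ lam) (hmu1 : 0 ≤ mu1) (hmu12 : mu1 < mu2) (hbeta : 0 ≤ beta)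
    (hsum : lam + mu1 + mu2 + beta = 1) (hmu : 0 ≤ mu) (hle : lam + mu ≤ 1)
    (hd : Monotone fun k => h (k + 1) - h k) (n L : ℕ)
    (hthr : ∀ m : ℕ, m < n → ∀ j : ℕ, 1 ≤ j → j ≤ L →
      VI lam mu1 mu2 beta c2 cmu mu 0 h m j true
          - VI lam mu1 mu2 beta c2 cmu mu 0 h m (j - 1) true ≤ c2 / (mu2 - mu1)) (m : ℕ) :
    m ≤ n → ∀ k : ℕ, k + 2 * m + 1 ≤ L →
      (m : ℝ) * (h (k + 2) - h (k + 1)) ≤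
          VI lam mu1 mu2 beta c2 cmu mu 0 h m (k + m + 1) true
            - VI lam mu1 mu2 beta c2 cmu mu 0 h m (k + m) true ∧
        VI lam mu1 mu2 beta c2 cmu mu 0 h m (k + m + 1) true
            - VI lam mu1 mu2 beta c2 cmu mu 0 h m (k + m) true ≤
          (m : ℝ) * (h (k + 2 * m + 1) - h (k + 2 * m)) := by
  induction m with
  | zero => intro _ k _; simp [VI]
  | succ m ih =>
    intro hmn k hkL
    have hm : (0 : ℝ) ≤ m := m.cast_nonneg
    have hpos : 0 < mu2 - mu1 := by linarith
    obtain ⟨l0, u0⟩ := ih (by omega) k (by omega)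
    obtain ⟨l1, u1⟩ := ih (by omega) (k + 1) (by omega)
    obtain ⟨l2, u2⟩ := ih (by omega) (k + 2) (by omega)
    obtain ⟨l3, u3⟩ := VI_false_increment_bounds lam mu1 mu2 beta c2 cmu mu h hlam hmu hle hd
      m (k + 1)
    have t1 := hthr m (by omega) (k + m + 2) (by omega) (by omega)
    have t0 := hthr m (by omega) (k + m + 1) (by omega) (by omega)
    rw [le_div_iff₀ hpos] at t0 t1
    have a1 : h (k + 2) - h (k + 1) ≤ h (k + 3) - h (k + 2) := hd (by omega : k + 1 ≤ k + 2)
    have a2 : h (k + 2) - h (k + 1) ≤ h (k + 4) - h (k + 3) := hd (by omega : k + 1 ≤ k + 3)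
    have a3 : h (k + 2) - h (k + 1) ≤ h (k + m + 2) - h (k + m + 1) :=
      hd (by omega : k + 1 ≤ k + m + 1)
    have b0 : h (k + 2 * m + 1) - h (k + 2 * m) ≤ h (k + 2 * m + 3) - h (k + 2 * m + 2) :=
      hd (by omega : k + 2 * m ≤ k + 2 * m + 2)
    have b1 : h (k + 2 * m + 2) - h (k + 2 * m + 1) ≤ h (k + 2 * m + 3) - h (k + 2 * m + 2) :=
      hd (by omega : k + 2 * m + 1 ≤ k + 2 * m + 2)
    have b3 : h (k + m + 2) - h (k + m + 1) ≤ h (k + 2 * m + 3) - h (k + 2 * m + 2) :=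
      hd (by omega : k + m + 1 ≤ k + 2 * m + 2)
    replace l1 := (mul_le_mul_of_nonneg_left a1 hm).trans l1
    replace l2 := (mul_le_mul_of_nonneg_left a2 hm).trans l2
    replace l3 := (mul_le_mul_of_nonneg_left a1 hm).trans l3
    rw [show k + 1 + 2 * m + 1 = k + 2 * m + 2 by omega,
      show k + 1 + 2 * m = k + 2 * m + 1 by omega] at u1 u3
    rw [show k + 2 + 2 * m + 1 = k + 2 * m + 3 by omega,
      show k + 2 + 2 * m = k + 2 * m + 2 by omega] at u2
    replace u0 := u0.trans (mul_le_mul_of_nonneg_left b0 hm)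
    replace u1 := u1.trans (mul_le_mul_of_nonneg_left b1 hm)
    replace u3 := u3.trans (mul_le_mul_of_nonneg_left b1 hm)
    rw [show k + 1 + m + 1 = k + m + 2 by omega, show k + 1 + m = k + m + 1 by omega]
      at l1 u1 l3 u3
    rw [show k + 2 + m + 1 = k + m + 3 by omega, show k + 2 + m = k + m + 2 by omega] at l2 u2
    rw [show k + (m + 1) + 1 = k + m + 2 by omega, show k + (m + 1) = k + m + 1 by omega,
      show k + 2 * (m + 1) + 1 = k + 2 * m + 3 by omega,
      show k + 2 * (m + 1) = k + 2 * m + 2 by omega]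
    simp only [show k + m + 2 - 1 = k + m + 1 by omega, show k + m + 1 - 1 = k + m by omega]
      at t0 t1
    simp only [VI, show k + m + 2 - 1 = k + m + 1 by omega, show k + m + 1 - 1 = k + m by omega,
      show k + m + 2 + 1 = k + m + 3 by omega, show k + m + 1 + 1 = k + m + 2 by omega]
    rw [min_eq_left (by linarith), min_eq_left (by linarith)]
    push_cast
    have weights : mu2 = 1 - lam - mu1 - beta := by linarith
    have hmu2 : 0 ≤ mu2 := by linarith
    constructor
    · have := mul_le_mul_of_nonneg_left l1 hmu2
      have := mul_le_mul_of_nonneg_left l0 hmu1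
      have := mul_le_mul_of_nonneg_left l2 hlam
      have := mul_le_mul_of_nonneg_left l3 hbeta
      subst weights
      linarith
    · have := mul_le_mul_of_nonneg_left u1 hmu2
      have := mul_le_mul_of_nonneg_left u0 hmu1
      have := mul_le_mul_of_nonneg_left u2 hlam
      have := mul_le_mul_of_nonneg_left u3 hbeta
      subst weights
      linarith


/-- Lemma 2 of the paper (non-discounted case `α = 0`): bounds on value-iteration
increments when all thresholds up to step `n` are at least `i + 2n`. -/
theorem stmt4
    (lam mu1 mu2 beta c2 cmu mu : ℝ) (h : ℕ → ℝ)
    (hlam : 0 < lam) (hmu1 : 0 < mu1) (hmu12 : mu1 < mu2) (hbeta : 0 < beta)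
    (hsum : lam + mu1 + mu2 + beta = 1) (hc2 : 0 < c2)
    (hmu : (mu = mu1 ∧ cmu = 0) ∨ (mu = mu2 ∧ cmu = c2)) (hstab : lam < mu)
    (hh0 : h 0 = 0) (hhnn : ∀ i : ℕ, 0 ≤ h i) (hhmono : ∀ i : ℕ, h i ≤ h (i + 1))
    (hhconv : ∀ j : ℕ, 1 ≤ j → h j - h (j - 1) ≤ h (j + 1) - h j)
    (i n : ℕ) (hin : n < i)
    (hthr : ∀ m : ℕ, m < n → ∀ j : ℕ, 1 ≤ j → j ≤ i + 2 * n →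
      VI lam mu1 mu2 beta c2 cmu mu 0 h m j true - VI lam mu1 mu2 beta c2 cmu mu 0 h m (j - 1) true ≤
        c2 / (mu2 - mu1)) :
    (n : ℝ) * (h (i - n + 1) - h (i - n)) ≤
        VI lam mu1 mu2 beta c2 cmu mu 0 h n i true - VI lam mu1 mu2 beta c2 cmu mu 0 h n (i - 1) true ∧
      VI lam mu1 mu2 beta c2 cmu mu 0 h n i true - VI lam mu1 mu2 beta c2 cmu mu 0 h n (i - 1) true ≤
        (n : ℝ) * (h (i + n) - h (i + n - 1)) := by
  have hd : Monotone fun k => h (k + 1) - h k :=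
    monotone_nat_of_le_succ fun k => by simpa using hhconv (k + 1) (by omega)
  have hmu0 : 0 ≤ mu := by linarith
  have hle : lam + mu ≤ 1 := by rcases hmu with ⟨rfl, _⟩ | ⟨rfl, _⟩ <;> linarith
  obtain ⟨k, rfl⟩ : ∃ k, i = k + n + 1 := ⟨i - n - 1, by omega⟩
  have key := VI_true_increment_bounds lam mu1 mu2 beta c2 cmu mu h hlam.le hmu1.le hmu12 hbeta.le
    hsum hmu0 hle hd n (k + n + 1 + 2 * n) hthr n le_rfl k (by omega)
  rwa [show k + n + 1 - n + 1 = k + 2 by omega, show k + n + 1 - n = k + 1 by omega,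
    show k + n + 1 + n - 1 = k + 2 * n by omega, show k + n + 1 + n = k + 2 * n + 1 by omega,
    show k + n + 1 - 1 = k + n by omega]
end

section
/- Let α ∈ (0,1). If h(i) − h(i−1) ≤ α·c2/((1−α)(μ2−μ1)) for every i ≥ 1, then the value-iteration thresholds are all infinite: for every n ∈ ℕ and every i ∈ ℕ, V_{α,n}(i,1) − V_{α,n}((i−1)⁺,1) ≤ c2/((1−α)(μ2−μ1)); that is, the slow rate μ1 is a minimising action at every state and every step of value iteration. -/
/-- Under a uniform bound `α·K` on the holding-cost increments, with
`K = c2 / ((1-α)(μ2-μ1))`, the increments of value iteration are at most `K` in both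
control states. -/
lemma VI_increment_le {lam mu1 mu2 beta c2 cmu mu α K : ℝ} {h : ℕ → ℝ}
    (hlam : 0 ≤ lam) (hmu1 : 0 ≤ mu1) (hmu12 : mu1 ≤ mu2) (hbeta : 0 ≤ beta)
    (hsum : lam + mu1 + mu2 + beta = 1) (hmu0 : 0 ≤ mu) (hmu : lam + mu ≤ 1)
    (hα1 : α ≤ 1) (hK0 : 0 ≤ K) (hK : (1 - α) * (mu2 - mu1) * K = c2)
    (hsmall : ∀ i : ℕ, h (i + 1) - h i ≤ α * K) (n i : ℕ) (q : Bool) :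
    VI lam mu1 mu2 beta c2 cmu mu α h n i q
      - VI lam mu1 mu2 beta c2 cmu mu α h n (i - 1) q ≤ K := by
  induction n generalizing i q with
  | zero => simpa [VI] using hK0
  | succ n ih =>
    have hα : 0 ≤ 1 - α := by linarith
    have slow_le : ∀ j : ℕ,
        (1 - α) * (mu2 - mu1) * VI lam mu1 mu2 beta c2 cmu mu α h n j true ≤
          c2 + (1 - α) * (mu2 - mu1) * VI lam mu1 mu2 beta c2 cmu mu α h n (j - 1) true := by
      intro j
      have := mul_le_mul_of_nonneg_left (ih j true)
        (mul_nonneg hα (sub_nonneg.2 hmu12))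
      linarith
    rcases i with _ | i
    · simpa using hK0
    have hh := hsmall i
    have below := ih i q
    have here := ih (i + 1) q
    have above := ih (i + 2) q
    have uncontrolled := ih (i + 1) false
    simp only [Nat.add_sub_cancel, Nat.add_succ_sub_one] at below here above uncontrolled ⊢
    cases q with
    | false =>
      simp only [VI, Nat.add_sub_cancel]
      have mix := mul_le_mul_of_nonneg_left
        (add_le_add (add_le_add (mul_le_mul_of_nonneg_left below hmu0)
          (mul_le_mul_of_nonneg_left here (by linarith : 0 ≤ 1 - lam - mu)))
          (mul_le_mul_of_nonneg_left above hlam)) hα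
      linarith
    | true =>
      simp only [VI]
      rw [min_eq_left (slow_le _), min_eq_left (slow_le _)]
      simp only [Nat.add_sub_cancel]
      have mix := mul_le_mul_of_nonneg_left
        (add_le_add (add_le_add (add_le_add (mul_le_mul_of_nonneg_left below hmu1)
          (mul_le_mul_of_nonneg_left here (by linarith : 0 ≤ mu2)))
          (mul_le_mul_of_nonneg_left above hlam))
          (mul_le_mul_of_nonneg_left uncontrolled hbeta)) hα
      have total : (1 - α) * (mu1 * K + mu2 * K + lam * K + beta * K) = (1 - α) * K := by
        linear_combination (1 - α) * K * hsum
      linarith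

/-- If the increments of the holding cost are uniformly at most
`α·c2/((1-α)(μ2-μ1))`, then all value-iteration thresholds are infinite:
the slow rate `μ1` is a minimising action at every state and every step. -/
theorem stmt5
    (lam mu1 mu2 beta c2 cmu mu : ℝ) (h : ℕ → ℝ)
    (hlam : 0 < lam) (hmu1 : 0 < mu1) (hmu12 : mu1 < mu2) (hbeta : 0 < beta)
    (hsum : lam + mu1 + mu2 + beta = 1) (hc2 : 0 < c2)
    (hmu : (mu = mu1 ∧ cmu = 0) ∨ (mu = mu2 ∧ cmu = c2)) (hstab : lam < mu)
    (hh0 : h 0 = 0) (hhnn : ∀ i : ℕ, 0 ≤ h i) (hhmono : ∀ i : ℕ, h i ≤ h (i + 1))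
    (hhconv : ∀ j : ℕ, 1 ≤ j → h j - h (j - 1) ≤ h (j + 1) - h j)
    (α : ℝ) (hα0 : 0 < α) (hα1 : α < 1)
    (hsmall : ∀ i : ℕ, 1 ≤ i → h i - h (i - 1) ≤ α * c2 / ((1 - α) * (mu2 - mu1))) :
    ∀ (n i : ℕ),
      VI lam mu1 mu2 beta c2 cmu mu α h n i true - VI lam mu1 mu2 beta c2 cmu mu α h n (i - 1) true ≤
        c2 / ((1 - α) * (mu2 - mu1)) := by
  intro n i
  have hα : 0 < 1 - α := by linarith
  have hpos : 0 < (1 - α) * (mu2 - mu1) := mul_pos hα (sub_pos.2 hmu12)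
  have hmu_le : mu ≤ mu2 := by rcases hmu with ⟨hm, -⟩ | ⟨hm, -⟩ <;> linarith
  refine VI_increment_le hlam.le hmu1.le hmu12.le hbeta.le hsum (by linarith)
    (by linarith) hα1.le (div_pos hc2 hpos).le (mul_div_cancel₀ _ hpos.ne')
    (fun j => ?_) n i true
  have := hsmall (j + 1) (by omega)
  rwa [Nat.add_sub_cancel, mul_div_assoc] at this
end

section
/- Let α ∈ (0,1) and let j ≥ 2 satisfy h(j) − h(j−1) > α·c2/((1−α)(μ2−μ1)). Let n ≥ 1 be any integer with ((1−(1−α)^n)/α)·(h(j) − h(j−1)) > c2/((1−α)(μ2−μ1)). Then the value-iteration threshold at step n+1 is finite and bounded by j + 3n − 1: there exists i′ with 1 ≤ i′ ≤ j + 3n − 1 such that V_{α,n}(i′,1) − V_{α,n}(i′−1,1) > c2/((1−α)(μ2−μ1)). -/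
/-- The increments of a convex sequence are nondecreasing. -/
theorem sub_pred_le_sub_of_convex (h : ℕ → ℝ)
    (hhconv : ∀ j : ℕ, 1 ≤ j → h j - h (j - 1) ≤ h (j + 1) - h j)
    {j i : ℕ} (hj : 1 ≤ j) (hij : j ≤ i + 1) : h j - h (j - 1) ≤ h (i + 1) - h i := by
  have key : ∀ k, j ≤ k → h j - h (j - 1) ≤ h k - h (k - 1) := by
    intro k hk
    induction k, hk using Nat.le_induction with
    | base => exact le_rfl
    | succ k hk ih => exact ih.trans (by simpa using hhconv k (hj.trans hk))
  simpa using key (i + 1) hij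

/-- The optimal service term has increments at least as large as a common lower bound, scaled
by `K`, on two consecutive increments of the value function. -/
theorem mul_le_min_sub_min {K c x y z d : ℝ} (hK : 0 ≤ K) (hyz : d ≤ z - y) (hxy : d ≤ y - x) :
    K * d ≤ min (K * z) (c + K * y) - min (K * y) (c + K * x) := by
  have h1 := mul_le_mul_of_nonneg_left hyz hK
  have h2 := mul_le_mul_of_nonneg_left hxy hK
  have h3 := min_le_left (K * y) (c + K * x)
  have h4 := min_le_right (K * y) (c + K * x)
  rw [le_sub_iff_add_le]
  apply le_min <;> linarith

/-- Away from the boundary, the increments of the value iterates dominate the discounted sum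
of a fixed increment of the holding cost. -/
theorem mul_le_VI_sub
    (lam mu1 mu2 beta c2 cmu mu : ℝ) (h : ℕ → ℝ)
    (hlam : 0 ≤ lam) (hmu1 : 0 ≤ mu1) (hmu12 : mu1 ≤ mu2) (hbeta : 0 ≤ beta)
    (hsum : lam + mu1 + mu2 + beta = 1) (hmu : 0 ≤ mu) (hlm : lam + mu ≤ 1)
    (hhconv : ∀ j : ℕ, 1 ≤ j → h j - h (j - 1) ≤ h (j + 1) - h j)
    (α : ℝ) (hα0 : α ≠ 0) (hα1 : α ≤ 1) (j : ℕ) (hj : 1 ≤ j) (n : ℕ) :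
    ∀ i : ℕ, j + n ≤ i + 1 → ∀ q : Bool,
      ((1 - (1 - α) ^ n) / α) * (h j - h (j - 1)) ≤
        VI lam mu1 mu2 beta c2 cmu mu α h n (i + 1) q
          - VI lam mu1 mu2 beta c2 cmu mu α h n i q := by
  induction n with
  | zero => intro i _ q; simp [VI]
  | succ n ih =>
    intro i hi q
    obtain ⟨k, rfl⟩ : ∃ k, i = k + 1 := ⟨i - 1, by omega⟩
    have hh := sub_pred_le_sub_of_convex h hhconv hj (i := k + 1) (by omega)
    have hrec : ((1 - (1 - α) ^ (n + 1)) / α) * (h j - h (j - 1))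
        = (h j - h (j - 1)) + (1 - α) * (((1 - (1 - α) ^ n) / α) * (h j - h (j - 1))) := by
      field_simp
      ring
    rw [hrec]
    have I0 := ih k (by omega)
    have I1 := ih (k + 1) (by omega)
    have I2 := ih (k + 1 + 1) (by omega)
    generalize ((1 - (1 - α) ^ n) / α) * (h j - h (j - 1)) = d at *
    have hα : 0 ≤ 1 - α := by linarith
    cases q with
    | false =>
      have a0 := mul_le_mul_of_nonneg_left (I0 false) (mul_nonneg hα hmu)
      have a1 := mul_le_mul_of_nonneg_left (I1 false)
        (mul_nonneg hα (show 0 ≤ 1 - lam - mu by linarith))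
      have a2 := mul_le_mul_of_nonneg_left (I2 false) (mul_nonneg hα hlam)
      simp only [VI, Nat.add_sub_cancel]
      linarith
    | true =>
      have a0 := mul_le_mul_of_nonneg_left (I0 true) (mul_nonneg hα hmu1)
      have a1 := mul_le_mul_of_nonneg_left (I1 true) (mul_nonneg hα hmu1)
      have a2 := mul_le_mul_of_nonneg_left (I2 true) (mul_nonneg hα hlam)
      have a3 := mul_le_mul_of_nonneg_left (I1 false) (mul_nonneg hα hbeta)
      have a4 := mul_le_min_sub_min (c := c2)
        (mul_nonneg hα (sub_nonneg.2 hmu12)) (I1 true) (I0 true)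
      have hd : (1 - α) * d = (1 - α) * mu1 * d + (1 - α) * mu1 * d + (1 - α) * lam * d
          + (1 - α) * beta * d + (1 - α) * (mu2 - mu1) * d := by
        linear_combination -((1 - α) * d) * hsum
      simp only [VI, Nat.add_sub_cancel]
      linarith

/-- Discounted case: if some holding-cost increment is large enough, the
value-iteration threshold at step `n+1` is finite and bounded by `j + 3n - 1`. -/
theorem stmt6
    (lam mu1 mu2 beta c2 cmu mu : ℝ) (h : ℕ → ℝ)
    (hlam : 0 < lam) (hmu1 : 0 < mu1) (hmu12 : mu1 < mu2) (hbeta : 0 < beta)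
    (hsum : lam + mu1 + mu2 + beta = 1) (hc2 : 0 < c2)
    (hmu : (mu = mu1 ∧ cmu = 0) ∨ (mu = mu2 ∧ cmu = c2)) (hstab : lam < mu)
    (hh0 : h 0 = 0) (hhnn : ∀ i : ℕ, 0 ≤ h i) (hhmono : ∀ i : ℕ, h i ≤ h (i + 1))
    (hhconv : ∀ j : ℕ, 1 ≤ j → h j - h (j - 1) ≤ h (j + 1) - h j)
    (α : ℝ) (hα0 : 0 < α) (hα1 : α < 1)
    (j : ℕ) (hj : 2 ≤ j)
    (hjh : α * c2 / ((1 - α) * (mu2 - mu1)) < h j - h (j - 1))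
    (n : ℕ) (hn : 1 ≤ n)
    (hnbig : c2 / ((1 - α) * (mu2 - mu1)) < ((1 - (1 - α) ^ n) / α) * (h j - h (j - 1))) :
    ∃ i' : ℕ, 1 ≤ i' ∧ i' ≤ j + 3 * n - 1 ∧
      c2 / ((1 - α) * (mu2 - mu1)) <
        VI lam mu1 mu2 beta c2 cmu mu α h n i' true - VI lam mu1 mu2 beta c2 cmu mu α h n (i' - 1) true := by
  have hmu0 : 0 ≤ mu := (hlam.trans hstab).le
  have hlm : lam + mu ≤ 1 := by rcases hmu with ⟨rfl, -⟩ | ⟨rfl, -⟩ <;> linarith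
  refine ⟨j + n, by omega, by omega, hnbig.trans_le ?_⟩
  have key := mul_le_VI_sub lam mu1 mu2 beta c2 cmu mu h hlam.le hmu1.le hmu12.le hbeta.le hsum
    hmu0 hlm hhconv α hα0.ne' hα1.le j (by omega) n (j + n - 1) (by omega) true
  rwa [show j + n - 1 + 1 = j + n by omega] at key
end

section
/- (Non-discounted case, α = 0.) Let j ≥ 2 satisfy h(j) > h(j−1), and set n = ⌈c2/((h(j) − h(j−1))·(μ2 − μ1))⌉ + 1. Then the value-iteration threshold at step n+1 is finite and bounded by j + 3n − 1: there exists i′ with 1 ≤ i′ ≤ j + 3n − 1 such that V_{0,n}(i′,1) − V_{0,n}(i′−1,1) > c2/(μ2 − μ1). -/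
/-- The increments of a convex sequence are nondecreasing. -/
theorem increment_le_of_convex (h : ℕ → ℝ)
    (hconv : ∀ j : ℕ, 1 ≤ j → h j - h (j - 1) ≤ h (j + 1) - h j)
    (j i : ℕ) (hj : 1 ≤ j) (hji : j ≤ i) : h j - h (j - 1) ≤ h i - h (i - 1) := by
  induction i, hji using Nat.le_induction with
  | base => exact le_rfl
  | succ m hm ih => exact ih.trans (hconv m (hj.trans hm))

/-- The optimal-service term of the control state has increments at least `δ * x` as soon as
the increments of the value function are at least `x`. -/
theorem le_min_sub_min (δ c x u v w : ℝ) (hδ : 0 ≤ δ) (huv : x ≤ v - u) (hvw : x ≤ w - v) :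
    δ * x ≤ min (δ * w) (c + δ * v) - min (δ * v) (c + δ * u) := by
  have h1 := mul_le_mul_of_nonneg_left huv hδ
  have h2 := mul_le_mul_of_nonneg_left hvw hδ
  rcases min_choice (δ * w) (c + δ * v) with e | e <;> rw [e]
  · linarith [min_le_left (δ * v) (c + δ * u)]
  · linarith [min_le_right (δ * v) (c + δ * u)]

/-- Undiscounted value iteration: if the holding-cost increments are at least `d` from `j` on,
then after `n` steps the increments of the value function are at least `n * d` from `j + n` on,
with and without control. -/
theorem VI_increment_ge (lam mu1 mu2 beta c2 cmu mu : ℝ) (h : ℕ → ℝ)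
    (hlam : 0 ≤ lam) (hmu1 : 0 ≤ mu1) (hmu12 : mu1 ≤ mu2) (hbeta : 0 ≤ beta)
    (hsum : lam + mu1 + mu2 + beta = 1) (hmu : 0 ≤ mu) (hlm : lam + mu ≤ 1)
    (d : ℝ) (j : ℕ) (hj : 2 ≤ j) (hd : ∀ i, j ≤ i → d ≤ h i - h (i - 1))
    (n i : ℕ) (hi : j + n ≤ i) (q : Bool) :
    n * d ≤ VI lam mu1 mu2 beta c2 cmu mu 0 h n i q
      - VI lam mu1 mu2 beta c2 cmu mu 0 h n (i - 1) q := by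
  induction n generalizing i q with
  | zero => simp [VI]
  | succ n ih =>
    obtain ⟨l, rfl⟩ : ∃ l, i = l + 3 := ⟨i - 3, by omega⟩
    have hh := hd (l + 3) (by omega)
    have a := fun q => ih (l + 2) (by omega) q
    have b := fun q => ih (l + 3) (by omega) q
    have c := fun q => ih (l + 4) (by omega) q
    simp only [show l + 3 - 1 = l + 2 from rfl,
      show l + 2 - 1 = l + 1 from rfl, show l + 4 - 1 = l + 3 from rfl] at hh a b c ⊢
    push_cast
    cases q
    · simp only [VI, show l + 3 - 1 = l + 2 from rfl, show l + 2 - 1 = l + 1 from rfl, sub_zero,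
        one_mul]
      have e1 := mul_le_mul_of_nonneg_left (a false) hmu
      have e2 := mul_le_mul_of_nonneg_left (b false) (by linarith : 0 ≤ 1 - lam - mu)
      have e3 := mul_le_mul_of_nonneg_left (c false) hlam
      linarith
    · simp only [VI, show l + 3 - 1 = l + 2 from rfl, show l + 2 - 1 = l + 1 from rfl, sub_zero,
        one_mul]
      have e1 := mul_le_mul_of_nonneg_left (a true) hmu1
      have e2 := mul_le_mul_of_nonneg_left (b true) hmu1
      have e3 := mul_le_mul_of_nonneg_left (c true) hlam
      have e4 := mul_le_mul_of_nonneg_left (b false) hbeta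
      have e5 := le_min_sub_min (mu2 - mu1) c2 _ _ _ _ (sub_nonneg.2 hmu12) (a true) (b true)
      have e6 : n * d = (lam + mu1 + mu2 + beta) * (n * d) := by rw [hsum, one_mul]
      linarith

/-- Non-discounted case `α = 0`: with `n = ⌈c2/((h(j)-h(j-1))(μ2-μ1))⌉ + 1`, the
value-iteration threshold at step `n+1` is finite and bounded by `j + 3n - 1`. -/
theorem stmt7
    (lam mu1 mu2 beta c2 cmu mu : ℝ) (h : ℕ → ℝ)
    (hlam : 0 < lam) (hmu1 : 0 < mu1) (hmu12 : mu1 < mu2) (hbeta : 0 < beta)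
    (hsum : lam + mu1 + mu2 + beta = 1) (hc2 : 0 < c2)
    (hmu : (mu = mu1 ∧ cmu = 0) ∨ (mu = mu2 ∧ cmu = c2)) (hstab : lam < mu)
    (hh0 : h 0 = 0) (hhnn : ∀ i : ℕ, 0 ≤ h i) (hhmono : ∀ i : ℕ, h i ≤ h (i + 1))
    (hhconv : ∀ j : ℕ, 1 ≤ j → h j - h (j - 1) ≤ h (j + 1) - h j)
    (j : ℕ) (hj : 2 ≤ j) (hjh : h (j - 1) < h j) :
    ∃ i' : ℕ, 1 ≤ i' ∧ i' ≤ j + 3 * (⌈c2 / ((h j - h (j - 1)) * (mu2 - mu1))⌉₊ + 1) - 1 ∧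
      c2 / (mu2 - mu1) <
        VI lam mu1 mu2 beta c2 cmu mu 0 h (⌈c2 / ((h j - h (j - 1)) * (mu2 - mu1))⌉₊ + 1) i' true - VI lam mu1 mu2 beta c2 cmu mu 0 h (⌈c2 / ((h j - h (j - 1)) * (mu2 - mu1))⌉₊ + 1) (i' - 1) true := by
  have hδ : 0 < mu2 - mu1 := sub_pos.2 hmu12
  have hd : 0 < h j - h (j - 1) := sub_pos.2 hjh
  set N := ⌈c2 / ((h j - h (j - 1)) * (mu2 - mu1))⌉₊
  have hmu0 : 0 ≤ mu ∧ lam + mu ≤ 1 := by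
    rcases hmu with ⟨rfl, -⟩ | ⟨rfl, -⟩ <;> constructor <;> linarith
  refine ⟨j + (N + 1), by omega, by omega, lt_of_lt_of_le ?_
    (VI_increment_ge lam mu1 mu2 beta c2 cmu mu h hlam.le hmu1.le hmu12.le hbeta.le hsum
      hmu0.1 hmu0.2 (h j - h (j - 1)) j hj
      (fun i hi => increment_le_of_convex h hhconv j i (by omega) hi) (N + 1) _ le_rfl true)⟩
  have hceil : c2 / ((h j - h (j - 1)) * (mu2 - mu1)) ≤ N := Nat.le_ceil _
  rw [div_le_iff₀ (mul_pos hd hδ)] at hceil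
  rw [div_lt_iff₀ hδ]
  push_cast
  linarith [mul_pos hd hδ]
end

section
/- The one-step value-iteration operator is a contraction in the γ-weighted supremum norm: let α ∈ (0,1), γ > 1 and C ≥ 0, and let T map a function f : ℕ × {0,1} → ℝ to Tf defined by Tf(i,0) = cμ + h(i) + (1−α)·[μ·f((i−1)⁺,0) + (1−λ−μ)·f(i,0) + λ·f(i+1,0)] and Tf(i,1) = h(i) + (1−α)·[μ1·f(i,1) + μ1·f((i−1)⁺,1) + λ·f(i+1,1) + β·f(i,0)] + min{(1−α)(μ2−μ1)·f(i,1), c2 + (1−α)(μ2−μ1)·f((i−1)⁺,1)}. If f, g : ℕ × {0,1} → ℝ satisfy |f(i,q) − g(i,q)| ≤ C·γ^i for all i ∈ ℕ, q ∈ {0,1}, then |Tf(i,q) − Tg(i,q)| ≤ (1−α)·γ·C·γ^i for all i, q. -/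
/-- The one-step value-iteration operator of the uniformised M/M/1 queue with a
temporary control period; `q = false` is the state without control, `q = true` the
state with control; `i - 1` is `ℕ`-subtraction, i.e. `(i-1)⁺`. -/
noncomputable def VIstep (lam mu1 mu2 beta c2 cmu mu α : ℝ) (h : ℕ → ℝ)
    (f : ℕ → Bool → ℝ) : ℕ → Bool → ℝ :=
  fun i q =>
    match q with
    | false => cmu + h i + (1 - α) * (mu * f (i - 1) false
        + (1 - lam - mu) * f i false + lam * f (i + 1) false)
    | true => h i + (1 - α) * (mu1 * f i true + mu1 * f (i - 1) true
        + lam * f (i + 1) true + beta * f i false)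
        + min ((1 - α) * (mu2 - mu1) * f i true)
            (c2 + (1 - α) * (mu2 - mu1) * f (i - 1) true)

/-- The one-step value-iteration operator is a contraction in the `γ`-weighted
supremum norm, with contraction factor `(1-α)·γ`. -/
theorem stmt8
    (lam mu1 mu2 beta c2 cmu mu : ℝ) (h : ℕ → ℝ)
    (hlam : 0 < lam) (hmu1 : 0 < mu1) (hmu12 : mu1 < mu2) (hbeta : 0 < beta)
    (hsum : lam + mu1 + mu2 + beta = 1) (hc2 : 0 < c2)
    (hmu : (mu = mu1 ∧ cmu = 0) ∨ (mu = mu2 ∧ cmu = c2)) (hstab : lam < mu)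
    (hh0 : h 0 = 0) (hhnn : ∀ i : ℕ, 0 ≤ h i) (hhmono : ∀ i : ℕ, h i ≤ h (i + 1))
    (hhconv : ∀ j : ℕ, 1 ≤ j → h j - h (j - 1) ≤ h (j + 1) - h j)
    (α : ℝ) (hα0 : 0 < α) (hα1 : α < 1) (γ : ℝ) (hγ : 1 < γ) (C : ℝ) (hC : 0 ≤ C)
    (f g : ℕ → Bool → ℝ)
    (hfg : ∀ (i : ℕ) (q : Bool), |f i q - g i q| ≤ C * γ ^ i) :
    ∀ (i : ℕ) (q : Bool),
      |VIstep lam mu1 mu2 beta c2 cmu mu α h f i q - VIstep lam mu1 mu2 beta c2 cmu mu α h g i q| ≤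
        (1 - α) * γ * C * γ ^ i := by
  have hbound : ∀ (i j : ℕ) (q : Bool), j ≤ i + 1 → |f j q - g j q| ≤ γ * C * γ ^ i := by
    intro i j q hj
    calc |f j q - g j q| ≤ C * γ ^ j := hfg j q
      _ ≤ C * γ ^ (i + 1) := by gcongr; exact hγ.le
      _ = γ * C * γ ^ i := by ring
  have hα : 0 ≤ 1 - α := by linarith
  have hmul : ∀ {w x M : ℝ}, 0 ≤ w → |x| ≤ M → |w * x| ≤ w * M := by
    intro w x M hw hx
    rw [abs_mul, abs_of_nonneg hw]
    exact mul_le_mul_of_nonneg_left hx hw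
  intro i q
  have hpred := fun q => hbound i (i - 1) q (by omega)
  have hself := fun q => hbound i i q (by omega)
  have hsucc := fun q => hbound i (i + 1) q le_rfl
  rw [show (1 - α) * γ * C * γ ^ i = (1 - α) * (γ * C * γ ^ i) by ring]
  generalize γ * C * γ ^ i = M at hpred hself hsucc ⊢
  cases q with
  | false =>
    have hmu0 : 0 ≤ mu := by linarith
    have hstay : 0 ≤ 1 - lam - mu := by rcases hmu with ⟨rfl, -⟩ | ⟨rfl, -⟩ <;> linarith
    simp only [VIstep]
    have key : |mu * (f (i - 1) false - g (i - 1) false)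
        + (1 - lam - mu) * (f i false - g i false)
        + lam * (f (i + 1) false - g (i + 1) false)| ≤ M :=
      (abs_add_three _ _ _).trans <| by
        linarith [hmul hmu0 (hpred false), hmul hstay (hself false), hmul hlam.le (hsucc false)]
    refine le_trans (le_of_eq ?_) (hmul hα key)
    congr 1
    ring
  | true =>
    have hdiff : 0 ≤ mu2 - mu1 := by linarith
    have hmin := abs_min_sub_min_le_max ((1 - α) * (mu2 - mu1) * f i true)
      (c2 + (1 - α) * (mu2 - mu1) * f (i - 1) true) ((1 - α) * (mu2 - mu1) * g i true)
      (c2 + (1 - α) * (mu2 - mu1) * g (i - 1) true)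
    rw [add_sub_add_left_eq_sub, ← mul_sub, ← mul_sub] at hmin
    replace hmin := hmin.trans <|
      max_le (hmul (mul_nonneg hα hdiff) (hself true)) (hmul (mul_nonneg hα hdiff) (hpred true))
    have key : |mu1 * (f i true - g i true) + mu1 * (f (i - 1) true - g (i - 1) true)
        + lam * (f (i + 1) true - g (i + 1) true) + beta * (f i false - g i false)|
        ≤ (mu1 + mu1 + lam + beta) * M := by
      refine (abs_add_le _ _).trans ((add_le_add_left (abs_add_three _ _ _) _).trans ?_)
      linarith [hmul hmu1.le (hself true), hmul hmu1.le (hpred true), hmul hlam.le (hsucc true),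
        hmul hbeta.le (hself false)]
    have htotal : (1 - α) * ((mu1 + mu1 + lam + beta) * M) + (1 - α) * (mu2 - mu1) * M
        = (1 - α) * M := by
      linear_combination (1 - α) * M * hsum
    rw [← htotal]
    refine le_trans (le_of_eq ?_) ((abs_add_le _ _).trans (add_le_add (hmul hα key) hmin))
    simp only [VIstep]
    congr 1
    ring
end

section
/- Convergence of value iteration with geometric rate in the discounted case: let α ∈ (0,1), let γ satisfy 1 < γ < 1/(1−α), and let u > 0 satisfy c2 + h(i) ≤ u·γ^i for all i ∈ ℕ. Then there exists a unique function V : ℕ × {0,1} → ℝ with sup_{i,q} |V(i,q)|·γ^{−i} < ∞ satisfying the discounted optimality equations V(i,0) = cμ + h(i) + (1−α)·[μ·V((i−1)⁺,0) + (1−λ−μ)·V(i,0) + λ·V(i+1,0)] and V(i,1) = h(i) + (1−α)·[μ1·V(i,1) + μ1·V((i−1)⁺,1) + λ·V(i+1,1) + β·V(i,0)] + min{(1−α)(μ2−μ1)·V(i,1), c2 + (1−α)(μ2−μ1)·V((i−1)⁺,1)} for all i; moreover, for every n ∈ ℕ, i ∈ ℕ and q ∈ {0,1}: |V(i,q) −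 V_{α,n}(i,q)| ≤ ((1−α)γ)^n · u · γ^i / (1 − (1−α)γ). -/
open Filter Topology

/-- The Bellman operator whose iterates are `VI` and whose fixed points solve the optimality
equations. -/
noncomputable def bellman (lam mu1 mu2 beta c2 cmu mu α : ℝ) (h : ℕ → ℝ) (V : ℕ → Bool → ℝ)
    (i : ℕ) : Bool → ℝ
  | false => cmu + h i + (1 - α) * (mu * V (i - 1) false
      + (1 - lam - mu) * V i false + lam * V (i + 1) false)
  | true => h i + (1 - α) * (mu1 * V i true + mu1 * V (i - 1) true
      + lam * V (i + 1) true + beta * V i false)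
      + min ((1 - α) * (mu2 - mu1) * V i true) (c2 + (1 - α) * (mu2 - mu1) * V (i - 1) true)

lemma VI_succ (lam mu1 mu2 beta c2 cmu mu α : ℝ) (h : ℕ → ℝ) (n i : ℕ) (q : Bool) :
    VI lam mu1 mu2 beta c2 cmu mu α h (n + 1) i q =
      bellman lam mu1 mu2 beta c2 cmu mu α h (VI lam mu1 mu2 beta c2 cmu mu α h n) i q := by
  cases q <;> simp only [VI, bellman]

/-- A pointwise limit passes through the Bellman operator. -/
lemma tendsto_bellman (lam mu1 mu2 beta c2 cmu mu α : ℝ) (h : ℕ → ℝ)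
    {F : ℕ → ℕ → Bool → ℝ} {V : ℕ → Bool → ℝ}
    (hF : ∀ i q, Tendsto (fun n => F n i q) atTop (𝓝 (V i q))) (i : ℕ) (q : Bool) :
    Tendsto (fun n => bellman lam mu1 mu2 beta c2 cmu mu α h (F n) i q) atTop
      (𝓝 (bellman lam mu1 mu2 beta c2 cmu mu α h V i q)) := by
  cases q
  · exact (((((hF (i - 1) false).const_mul _).add ((hF i false).const_mul _)).add
      ((hF (i + 1) false).const_mul _)).const_mul _).const_add _
  · exact (((((((hF i true).const_mul _).add ((hF (i - 1) true).const_mul _)).add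
      ((hF (i + 1) true).const_mul _)).add ((hF i false).const_mul _)).const_mul _).const_add _).add
      (((hF i true).const_mul _).min (((hF (i - 1) true).const_mul _).const_add _))

/-- The Bellman operator is a contraction with modulus `(1 - α) * γ` in the `γ ^ i`-weighted
supremum norm. -/
lemma abs_bellman_sub_bellman_le {lam mu1 mu2 beta mu α γ : ℝ} (c2 cmu : ℝ) (h : ℕ → ℝ)
    (hlam : 0 ≤ lam) (hmu1 : 0 ≤ mu1) (hmu12 : mu1 ≤ mu2) (hbeta : 0 ≤ beta)
    (hsum : lam + mu1 + mu2 + beta = 1) (hmu : 0 ≤ mu) (hmu' : lam + mu ≤ 1)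
    (hα1 : α ≤ 1) (hγ1 : 1 ≤ γ) {V W : ℕ → Bool → ℝ} {D : ℝ}
    (hD : ∀ i q, |V i q - W i q| ≤ D * γ ^ i) (i : ℕ) (q : Bool) :
    |bellman lam mu1 mu2 beta c2 cmu mu α h V i q
      - bellman lam mu1 mu2 beta c2 cmu mu α h W i q| ≤ (1 - α) * γ * D * γ ^ i := by
  have hD0 : 0 ≤ D := by simpa using (abs_nonneg _).trans (hD 0 true)
  have hα : 0 ≤ 1 - α := sub_nonneg.2 hα1
  have key : ∀ j q, j ≤ i + 1 → |V j q - W j q| ≤ D * γ ^ (i + 1) := fun j q hj =>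
    (hD j q).trans (mul_le_mul_of_nonneg_left (pow_le_pow_right₀ hγ1 hj) hD0)
  have hw : ∀ {a : ℝ}, 0 ≤ a → ∀ j q, j ≤ i + 1 →
      |a * V j q - a * W j q| ≤ a * (D * γ ^ (i + 1)) := fun {a} ha j q hj => by
    rw [← mul_sub, abs_mul, abs_of_nonneg ha]
    exact mul_le_mul_of_nonneg_left (key j q hj) ha
  have e : (1 - α) * γ * D * γ ^ i = (1 - α) * (D * γ ^ (i + 1)) := by ring
  rw [e]
  set E := D * γ ^ (i + 1)
  cases q
  · have h1 := hw (mul_nonneg hα hmu) (i - 1) false (by omega)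
    have h2 := hw (mul_nonneg hα (by linarith : 0 ≤ 1 - lam - mu)) i false (by omega)
    have h3 := hw (mul_nonneg hα hlam) (i + 1) false le_rfl
    simp only [bellman]
    rw [abs_le] at *
    constructor <;> linarith
  · have h1 := hw (mul_nonneg hα hmu1) i true (by omega)
    have h2 := hw (mul_nonneg hα hmu1) (i - 1) true (by omega)
    have h3 := hw (mul_nonneg hα hlam) (i + 1) true le_rfl
    have h4 := hw (mul_nonneg hα hbeta) i false (by omega)
    have h5 : |min ((1 - α) * (mu2 - mu1) * V i true)
          (c2 + (1 - α) * (mu2 - mu1) * V (i - 1) true)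
        - min ((1 - α) * (mu2 - mu1) * W i true)
          (c2 + (1 - α) * (mu2 - mu1) * W (i - 1) true)| ≤ (1 - α) * (mu2 - mu1) * E := by
      refine (abs_min_sub_min_le_max _ _ _ _).trans (max_le ?_ ?_)
      · exact hw (mul_nonneg hα (sub_nonneg.2 hmu12)) i true (by omega)
      · rw [add_sub_add_left_eq_sub]
        exact hw (mul_nonneg hα (sub_nonneg.2 hmu12)) (i - 1) true (by omega)
    have e : (1 - α) * E = (1 - α) * mu1 * E + (1 - α) * mu1 * E + (1 - α) * lam * E
        + (1 - α) * beta * E + (1 - α) * (mu2 - mu1) * E := by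
      linear_combination (-(1 - α) * E) * hsum
    simp only [bellman]
    rw [abs_le] at *
    constructor <;> linarith

/-- Convergence of value iteration with geometric rate in the discounted case:
existence and uniqueness of the `γ`-weighted-bounded solution of the discounted
optimality equations, and the geometric error bound for value iteration. -/
theorem stmt9
    (lam mu1 mu2 beta c2 cmu mu : ℝ) (h : ℕ → ℝ)
    (hlam : 0 < lam) (hmu1 : 0 < mu1) (hmu12 : mu1 < mu2) (hbeta : 0 < beta)
    (hsum : lam + mu1 + mu2 + beta = 1) (hc2 : 0 < c2)
    (hmu : (mu = mu1 ∧ cmu = 0) ∨ (mu = mu2 ∧ cmu = c2)) (hstab : lam < mu)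
    (hh0 : h 0 = 0) (hhnn : ∀ i : ℕ, 0 ≤ h i) (hhmono : ∀ i : ℕ, h i ≤ h (i + 1))
    (hhconv : ∀ j : ℕ, 1 ≤ j → h j - h (j - 1) ≤ h (j + 1) - h j)
    (α : ℝ) (hα0 : 0 < α) (hα1 : α < 1)
    (γ : ℝ) (hγ1 : 1 < γ) (hγ2 : γ < 1 / (1 - α))
    (u : ℝ) (hu : 0 < u) (hub : ∀ i : ℕ, c2 + h i ≤ u * γ ^ i) :
    (∃! V : ℕ → Bool → ℝ,
      (∃ B : ℝ, ∀ (i : ℕ) (q : Bool), |V i q| ≤ B * γ ^ i) ∧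
      (∀ i : ℕ,
        V i false = cmu + h i + (1 - α) * (mu * V (i - 1) false
            + (1 - lam - mu) * V i false + lam * V (i + 1) false) ∧
        V i true = h i + (1 - α) * (mu1 * V i true + mu1 * V (i - 1) true
            + lam * V (i + 1) true + beta * V i false)
          + min ((1 - α) * (mu2 - mu1) * V i true)
              (c2 + (1 - α) * (mu2 - mu1) * V (i - 1) true))) ∧
    (∀ V : ℕ → Bool → ℝ,
      (∃ B : ℝ, ∀ (i : ℕ) (q : Bool), |V i q| ≤ B * γ ^ i) →
      (∀ i : ℕ,
        V i false = cmu + h i + (1 - α) * (mu * V (i - 1) false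
            + (1 - lam - mu) * V i false + lam * V (i + 1) false) ∧
        V i true = h i + (1 - α) * (mu1 * V i true + mu1 * V (i - 1) true
            + lam * V (i + 1) true + beta * V i false)
          + min ((1 - α) * (mu2 - mu1) * V i true)
              (c2 + (1 - α) * (mu2 - mu1) * V (i - 1) true)) →
      ∀ (n i : ℕ) (q : Bool),
        |V i q - VI lam mu1 mu2 beta c2 cmu mu α h n i q| ≤
          ((1 - α) * γ) ^ n * u * γ ^ i / (1 - (1 - α) * γ)) := by
  have hα : 0 < 1 - α := sub_pos.2 hα1
  set κ := (1 - α) * γ with hκ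
  have hκ0 : 0 ≤ κ := by positivity
  have hκ1 : κ < 1 := by rwa [lt_div_iff₀ hα, mul_comm] at hγ2
  have hγ0 : 0 < γ := by linarith
  set T := bellman lam mu1 mu2 beta c2 cmu mu α h with hT
  set F := VI lam mu1 mu2 beta c2 cmu mu α h with hF
  have hFT : ∀ n i q, F (n + 1) i q = T (F n) i q := VI_succ lam mu1 mu2 beta c2 cmu mu α h
  have hcontr : ∀ {V W : ℕ → Bool → ℝ} {D : ℝ}, (∀ i q, |V i q - W i q| ≤ D * γ ^ i) →
      ∀ i q, |T V i q - T W i q| ≤ κ * D * γ ^ i := fun hD i q =>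
    abs_bellman_sub_bellman_le c2 cmu h hlam.le hmu1.le hmu12.le hbeta.le hsum
      (by linarith) (by rcases hmu with ⟨rfl, -⟩ | ⟨rfl, -⟩ <;> linarith) hα1.le hγ1.le hD i q
  have hstep0 : ∀ i q, |F 0 i q - F 1 i q| ≤ u * γ ^ i := fun i q => by
    have := hub i
    have := hhnn i
    cases q
    · simp only [hF, VI]
      rw [abs_le]
      rcases hmu with ⟨-, rfl⟩ | ⟨-, rfl⟩ <;> constructor <;> linarith
    · simp only [hF, VI, mul_zero, add_zero, min_eq_left hc2.le]
      rw [abs_le]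
      constructor <;> linarith
  have hstep : ∀ n i q, |F n i q - F (n + 1) i q| ≤ κ ^ n * u * γ ^ i := fun n => by
    induction n with
    | zero => simpa using hstep0
    | succ n ih =>
      intro i q
      rw [hFT n, hFT (n + 1), pow_succ', mul_assoc κ]
      exact hcontr ih i q
  have hdist : ∀ i q n, dist (F n i q) (F (n + 1) i q) ≤ u * γ ^ i * κ ^ n := fun i q n => by
    rw [Real.dist_eq]
    exact (hstep n i q).trans_eq (by ring)
  choose V hV using fun i q => cauchySeq_tendsto_of_complete
    (cauchySeq_of_le_geometric κ (u * γ ^ i) hκ1 (hdist i q))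
  have hVrate : ∀ n i q, |V i q - F n i q| ≤ κ ^ n * u * γ ^ i / (1 - κ) := fun n i q => by
    rw [abs_sub_comm, ← Real.dist_eq]
    exact (dist_le_of_le_geometric_of_tendsto κ _ hκ1 (hdist i q) (hV i q) n).trans_eq (by ring)
  have hVfix : ∀ i q, V i q = T V i q := fun i q =>
    tendsto_nhds_unique ((tendsto_add_atTop_iff_nat 1).2 (hV i q)) <| by
      simpa only [hFT] using tendsto_bellman lam mu1 mu2 beta c2 cmu mu α h hV i q
  have hVbdd : ∃ B : ℝ, ∀ i q, |V i q| ≤ B * γ ^ i := ⟨u / (1 - κ), fun i q => by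
    have := hVrate 0 i q
    simp only [hF, VI, sub_zero, pow_zero, one_mul] at this
    exact this.trans_eq (by ring)⟩
  have huniq : ∀ W : ℕ → Bool → ℝ, (∃ B : ℝ, ∀ i q, |W i q| ≤ B * γ ^ i) →
      (∀ i, W i false = T W i false ∧ W i true = T W i true) → W = V := by
    rintro W ⟨B, hB⟩ hW
    obtain ⟨C, hC⟩ := hVbdd
    have hWfix : ∀ i q, W i q = T W i q := fun i q => by
      cases q
      exacts [(hW i).1, (hW i).2]
    have hbound : ∀ n i q, |W i q - V i q| ≤ κ ^ n * (B + C) * γ ^ i := fun n => by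
      induction n with
      | zero =>
        intro i q
        have := abs_sub (W i q) (V i q)
        have := hB i q
        have := hC i q
        rw [pow_zero, one_mul, add_mul]
        linarith
      | succ n ih =>
        intro i q
        rw [hWfix, hVfix, pow_succ', mul_assoc κ]
        exact hcontr ih i q
    funext i q
    have hlim : Tendsto (fun n => κ ^ n * (B + C) * γ ^ i) atTop (𝓝 0) := by
      simpa using ((tendsto_pow_atTop_nhds_zero_of_lt_one hκ0 hκ1).mul_const (B + C)).mul_const
        (γ ^ i)
    exact sub_eq_zero.1 (abs_nonpos_iff.1 (ge_of_tendsto' hlim fun n => hbound n i q))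
  refine ⟨⟨V, ⟨hVbdd, fun i => ⟨hVfix i false, hVfix i true⟩⟩, fun W hW => huniq W hW.1 hW.2⟩, ?_⟩
  intro W hWb hW n i q
  rw [huniq W hWb hW]
  exact hVrate n i q
end

section
/- M-uniform geometric recurrence when the slow rate is stabilising: assume in addition λ < μ1. Let ζ satisfy 1 < ζ < min(μ1/λ, 1 + β/λ), define M(i,0) = ζ^i/2 and M(i,1) = ζ^i, and set η = max{ 1 − λ + λζ − β, μ/ζ + (1 − λ − μ) + λζ, μ1/ζ + (1 − λ − β/2 − μ1) + λζ }. Then η < 1, and for every action a ∈ {μ1, μ2} and every state x ∈ ℕ × {0,1}, the taboo drift inequality holds: ∑_{y ≠ (0,0)} p^a(x,y)·M(y) ≤ η·M(x). -/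
/-- One-step transition probabilities of the uniformised M/M/1 queue with a temporary
control period, under action (service rate) `a ∈ {μ1, μ2}` in the control states.
States are pairs `(i, q)` with `q = true` the control state and `q = false` the
state without control (where the fixed rate `mu` is used). -/
noncomputable def trP (lam beta mu a : ℝ) : ℕ × Bool → ℕ × Bool → ℝ
  | (i, true), (j, true) =>
      if j = i + 1 then lam
      else if j + 1 = i then a
      else if j = i then 1 - lam - beta - (if i = 0 then 0 else a)
      else 0
  | (i, true), (j, false) => if j = i then beta else 0
  | (i, false), (j, false) =>
      if j = i + 1 then lam
      else if j + 1 = i then mu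
      else if j = i then 1 - lam - (if i = 0 then 0 else mu)
      else 0
  | (_, false), (_, true) => 0

/-- The weight function `M(i,0) = ζ^i/2`, `M(i,1) = ζ^i`. -/
noncomputable def Mwt (ζ : ℝ) : ℕ × Bool → ℝ
  | (i, false) => ζ ^ i / 2
  | (i, true) => ζ ^ i

/-- From the empty control state, only `(0, 1)` and `(1, 1)` contribute to the taboo sum. -/
theorem tsum_taboo_control_zero (lam beta mu a ζ : ℝ) :
    (∑' y : ℕ × Bool,
        if y = ((0 : ℕ), false) then 0 else trP lam beta mu a (0, true) y * Mwt ζ y) =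
      1 - lam - beta + lam * ζ := by
  rw [tsum_eq_sum (s := {(0, true), (1, true)})]
  · simp [trP, Mwt]
  · rintro ⟨j, _ | _⟩ hj
    · simp_all [trP]
    · simp at hj
      simp [trP, hj]

theorem tsum_taboo_control_succ (lam beta mu a ζ : ℝ) (i : ℕ) :
    (∑' y : ℕ × Bool,
        if y = ((0 : ℕ), false) then 0 else trP lam beta mu a (i + 1, true) y * Mwt ζ y) =
      lam * ζ ^ (i + 2) + a * ζ ^ i + (1 - lam - beta - a) * ζ ^ (i + 1)
        + beta * (ζ ^ (i + 1) / 2) := by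
  rw [tsum_eq_sum (s := {(i + 2, true), (i, true), (i + 1, true), (i + 1, false)})]
  · have hne : i ≠ i + 1 + 1 := by omega
    simp [trP, Mwt, hne]
    ring
  · rintro ⟨j, _ | _⟩ hj
    · simp at hj
      simp [trP, hj]
    · simp at hj
      simp [trP, hj]

theorem tsum_taboo_free_zero (lam beta mu a ζ : ℝ) :
    (∑' y : ℕ × Bool,
        if y = ((0 : ℕ), false) then 0 else trP lam beta mu a (0, false) y * Mwt ζ y) =
      lam * (ζ / 2) := by
  rw [tsum_eq_sum (s := {(1, false)})]
  · simp [trP, Mwt]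
  · rintro ⟨j, _ | _⟩ hj
    · simp at hj
      by_cases h : j = 0 <;> simp [trP, hj, h]
    · simp [trP]

/-- An inequality only: for `i = 0` the downward jump leads to the taboo state `(0, 0)`. -/
theorem tsum_taboo_free_succ_le (lam beta mu a ζ : ℝ) (hmu : 0 ≤ mu) (i : ℕ) :
    (∑' y : ℕ × Bool,
        if y = ((0 : ℕ), false) then 0 else trP lam beta mu a (i + 1, false) y * Mwt ζ y) ≤
      lam * (ζ ^ (i + 2) / 2) + mu * (ζ ^ i / 2) + (1 - lam - mu) * (ζ ^ (i + 1) / 2) := by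
  rw [tsum_eq_sum (s := {(i + 2, false), (i, false), (i + 1, false)})]
  · by_cases h : i = 0
    · subst h
      simp [trP, Mwt]
      linarith
    · have hne : i ≠ i + 1 + 1 := by omega
      simp [trP, Mwt, h, hne]
      linarith
  · rintro ⟨j, _ | _⟩ hj
    · simp at hj
      simp [trP, hj]
    · simp [trP]

/-- `M`-uniform geometric recurrence when the slow rate is stabilising (`λ < μ1`):
the taboo drift inequality `∑_{y ≠ (0,0)} p^a(x,y) M(y) ≤ η M(x)` holds with `η < 1`. -/
theorem stmt10
    (lam mu1 mu2 beta mu : ℝ)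
    (hlam : 0 < lam) (hmu1 : 0 < mu1) (hmu12 : mu1 < mu2) (hbeta : 0 < beta)
    (hsum : lam + mu1 + mu2 + beta = 1)
    (hmu : mu = mu1 ∨ mu = mu2) (hstab : lam < mu)
    (hstab1 : lam < mu1)
    (ζ : ℝ) (hζ1 : 1 < ζ) (hζ2 : ζ < min (mu1 / lam) (1 + beta / lam))
    (η : ℝ)
    (hη : η = max (max (1 - lam + lam * ζ - beta)
        (mu / ζ + (1 - lam - mu) + lam * ζ))
        (mu1 / ζ + (1 - lam - beta / 2 - mu1) + lam * ζ)) :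
    η < 1 ∧
      ∀ a : ℝ, (a = mu1 ∨ a = mu2) → ∀ x : ℕ × Bool,
        (∑' y : ℕ × Bool,
            if y = ((0 : ℕ), false) then 0 else trP lam beta mu a x y * Mwt ζ y) ≤
          η * Mwt ζ x := by
  have hζ0 : 0 < ζ := by linarith
  obtain ⟨h1, h2⟩ := lt_min_iff.mp hζ2
  have h1 : lam * ζ < mu1 := by rw [lt_div_iff₀ hlam] at h1; linarith
  have h2 : lam * (ζ - 1) < beta := by
    rw [← sub_lt_iff_lt_add', lt_div_iff₀ hlam] at h2; linarith
  have hmu1_le : mu1 ≤ mu := by rcases hmu with h | h <;> linarith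
  have hmu_le : mu ≤ mu2 := by rcases hmu with h | h <;> linarith
  have drift_neg : ∀ m, mu1 ≤ m → m / ζ - m + lam * ζ - lam < 0 := by
    intro m hm
    have : m / ζ - m + lam * ζ - lam = (ζ - 1) * (lam * ζ - m) / ζ := by field_simp; ring
    rw [this]
    exact div_neg_of_neg_of_pos (mul_neg_of_pos_of_neg (by linarith) (by linarith)) hζ0
  have hA : 1 - lam + lam * ζ - beta ≤ η := by
    rw [hη]; exact (le_max_left _ _).trans (le_max_left _ _)
  have hB : mu / ζ + (1 - lam - mu) + lam * ζ ≤ η := by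
    rw [hη]; exact (le_max_right _ _).trans (le_max_left _ _)
  have hC : mu1 / ζ + (1 - lam - beta / 2 - mu1) + lam * ζ ≤ η := by
    rw [hη]; exact le_max_right _ _
  refine ⟨?_, ?_⟩
  · rw [hη]
    refine max_lt (max_lt (by linarith) ?_) ?_
    · linarith [drift_neg mu hmu1_le]
    · linarith [drift_neg mu1 le_rfl]
  rintro a ha ⟨_ | i, _ | _⟩
  · rw [tsum_taboo_free_zero]
    have : 0 < mu / ζ := by apply div_pos <;> linarith
    simp only [Mwt, pow_zero]
    linarith
  · rw [tsum_taboo_control_zero]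
    simp only [Mwt, pow_zero]
    linarith
  · refine (tsum_taboo_free_succ_le lam beta mu a ζ (by linarith) i).trans ?_
    have := mul_le_mul_of_nonneg_right hB (show 0 ≤ ζ ^ (i + 1) / 2 by positivity)
    refine le_trans (le_of_eq ?_) this
    field_simp
    ring
  · rw [tsum_taboo_control_succ]
    have ha1 : mu1 ≤ a := by rcases ha with h | h <;> linarith
    have hinv : a / ζ - a ≤ mu1 / ζ - mu1 := by
      have : (a - mu1) / ζ ≤ a - mu1 := div_le_self (by linarith) hζ1.le
      rw [sub_div] at this
      linarith
    have hD : a / ζ + (1 - lam - beta / 2 - a) + lam * ζ ≤ η := by linarith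
    have := mul_le_mul_of_nonneg_right hD (show 0 ≤ ζ ^ (i + 1) by positivity)
    refine le_trans (le_of_eq ?_) this
    field_simp
    ring
end

section
/- ε-approximation of the expected non-discounted saved cost under a geometric initial distribution: let ρ ∈ (0,1), ζ > 1 with ρζ < 1, η ∈ [0,1), u > 0 and ε > 0. Let H : ℕ × {0,1} → ℝ satisfy |H(i,q)| ≤ (u/(1−η))·ζ^i for all i, q. Let k ∈ ℕ satisfy (2u(1−ρ)/((1−η)(1−ρζ))) · (ρζ)^{k+1} ≤ ε/2, and let H̃ : ℕ → ℝ satisfy |H̃(i) − H(i,1)| ≤ ε/2 for every i ≤ k. Then the series ∑_{i=0}^∞ (1−ρ)ρ^i·(H(i,0) − H(i,1)) converges and | ∑_{i=0}^∞ (1−ρ)ρ^i·(H(i,0) − H(i,1)) − ∑_{i=0}^k (1−ρ)ρ^i·(H(i,0) − H̃(i)) | ≤ ε. -/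
/-- ε-approximation of the expected non-discounted saved cost under a geometric
initial distribution `(1-ρ)ρ^i`: the saved-cost series converges and the truncated
approximation using `H̃` is within `ε`. -/
theorem stmt14
    (ρ ζ η u ε : ℝ)
    (hρ0 : 0 < ρ) (hρ1 : ρ < 1) (hζ : 1 < ζ) (hρζ : ρ * ζ < 1)
    (hη0 : 0 ≤ η) (hη1 : η < 1) (hu : 0 < u) (hε : 0 < ε)
    (H : ℕ → Bool → ℝ)
    (hHb : ∀ (i : ℕ) (q : Bool), |H i q| ≤ (u / (1 - η)) * ζ ^ i)
    (k : ℕ)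
    (hk : (2 * u * (1 - ρ) / ((1 - η) * (1 - ρ * ζ))) * (ρ * ζ) ^ (k + 1) ≤ ε / 2)
    (Htil : ℕ → ℝ)
    (hHtil : ∀ i : ℕ, i ≤ k → |Htil i - H i true| ≤ ε / 2) :
    Summable (fun i : ℕ => (1 - ρ) * ρ ^ i * (H i false - H i true)) ∧
      |(∑' i : ℕ, (1 - ρ) * ρ ^ i * (H i false - H i true)) -
          ∑ i ∈ Finset.range (k + 1), (1 - ρ) * ρ ^ i * (H i false - Htil i)| ≤ ε := by
  set f : ℕ → ℝ := fun i => (1 - ρ) * ρ ^ i * (H i false - H i true) with hf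
  have hη : 0 < 1 - η := by linarith
  have hr : 0 < 1 - ρ * ζ := by linarith
  have hρ : 0 < 1 - ρ := by linarith
  have hr0 : 0 ≤ ρ * ζ := by positivity
  have hbound : ∀ i, ‖f i‖ ≤ 2 * u * (1 - ρ) / (1 - η) * (ρ * ζ) ^ i := by
    intro i
    have hw : 0 ≤ (1 - ρ) * ρ ^ i := by positivity
    have hdiff : |H i false - H i true| ≤ 2 * (u / (1 - η) * ζ ^ i) := by
      linarith [abs_sub (H i false) (H i true), hHb i false, hHb i true]
    calc ‖f i‖ = (1 - ρ) * ρ ^ i * |H i false - H i true| := by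
          rw [hf, Real.norm_eq_abs, abs_mul, abs_of_nonneg hw]
      _ ≤ (1 - ρ) * ρ ^ i * (2 * (u / (1 - η) * ζ ^ i)) :=
          mul_le_mul_of_nonneg_left hdiff hw
      _ = 2 * u * (1 - ρ) / (1 - η) * (ρ * ζ) ^ i := by rw [mul_pow]; ring
  have hgeom := hasSum_geometric_of_lt_one hr0 hρζ
  have hsum : Summable f :=
    Summable.of_norm_bounded (hgeom.summable.mul_left _) hbound
  refine ⟨hsum, ?_⟩
  have htail : |∑' i, f (i + (k + 1))| ≤ ε / 2 := by
    rw [← Real.norm_eq_abs]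
    refine le_trans (tsum_of_norm_bounded
      (hgeom.mul_left (2 * u * (1 - ρ) / (1 - η) * (ρ * ζ) ^ (k + 1))) fun i => ?_) ?_
    · refine (hbound (i + (k + 1))).trans_eq ?_
      rw [pow_add]; ring
    · refine le_trans (le_of_eq ?_) hk
      field_simp
  have hweights : ∑ i ∈ Finset.range (k + 1), (1 - ρ) * ρ ^ i ≤ 1 := by
    rw [← Finset.mul_sum, mul_neg_geom_sum]
    linarith [pow_pos hρ0 (k + 1)]
  have hhead : |∑ i ∈ Finset.range (k + 1), (1 - ρ) * ρ ^ i * (Htil i - H i true)| ≤ ε / 2 :=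
    calc |∑ i ∈ Finset.range (k + 1), (1 - ρ) * ρ ^ i * (Htil i - H i true)|
        ≤ ∑ i ∈ Finset.range (k + 1), (1 - ρ) * ρ ^ i * (ε / 2) := by
          refine (Finset.abs_sum_le_sum_abs _ _).trans (Finset.sum_le_sum fun i hi => ?_)
          have hw : 0 ≤ (1 - ρ) * ρ ^ i := by positivity
          rw [abs_mul, abs_of_nonneg hw]
          exact mul_le_mul_of_nonneg_left
            (hHtil i (Nat.lt_succ_iff.mp (Finset.mem_range.mp hi))) hw
      _ = (∑ i ∈ Finset.range (k + 1), (1 - ρ) * ρ ^ i) * (ε / 2) := by rw [Finset.sum_mul]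
      _ ≤ ε / 2 := mul_le_of_le_one_left (by positivity) hweights
  have hsplit : (∑' i, f i) - ∑ i ∈ Finset.range (k + 1), (1 - ρ) * ρ ^ i * (H i false - Htil i)
      = ∑ i ∈ Finset.range (k + 1), (1 - ρ) * ρ ^ i * (Htil i - H i true)
        + ∑' i, f (i + (k + 1)) := by
    rw [← hsum.sum_add_tsum_nat_add (k + 1), add_sub_right_comm, ← Finset.sum_sub_distrib]
    congr 1
    refine Finset.sum_congr rfl fun i _ => ?_
    rw [hf]; ring
  rw [hsplit]
  linarith [abs_add_le (∑ i ∈ Finset.range (k + 1), (1 - ρ) * ρ ^ i * (Htil i - H i true))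
    (∑' i, f (i + (k + 1)))]
end

section
/- Uniqueness of the weighted-bounded solution of the β-discounted optimality equation associated with the control period: let ζ satisfy 1 < ζ < 1/(1−β), and let R₁, R₂ : ℕ → ℝ be arbitrary functions (the one-step costs associated with the actions μ1 and μ2 respectively). Suppose u₁, u₂ : ℕ → ℝ both satisfy, for every i ∈ ℕ, u(i) = min{ R₁(i) + μ1·1_{i>0}·u(i−1) + (1 − β − λ − μ1·1_{i>0})·u(i) + λ·u(i+1), R₂(i) + μ2·1_{i>0}·u(i−1) + (1 − β − λ − μ2·1_{i>0})·u(i) + λ·u(i+1) }, and suppose sup_i |u₁(i)|·ζ^{−i} < ∞ and sup_i |u₂(i)|·ζ^{−i} < ∞. Then u₁ = u₂. -/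
/-- One step of a `ζ`-weighted contraction: a killed nearest-neighbour averaging operator maps
differences of weight `D * ζ ^ i` to differences of weight `(1 - beta) * ζ * D * ζ ^ i`. -/
theorem abs_birthDeath_sub_le {lam mu beta ζ D : ℝ} (hlam : 0 ≤ lam) (hmu : 0 ≤ mu)
    (hle : lam + mu + beta ≤ 1) (hζ : 1 ≤ ζ) {u v : ℕ → ℝ}
    (h : ∀ i, |u i - v i| ≤ D * ζ ^ i) (r : ℝ) (i : ℕ) :
    |(r + (if 0 < i then mu * u (i - 1) else 0)
        + (1 - beta - lam - (if 0 < i then mu else 0)) * u i + lam * u (i + 1))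
      - (r + (if 0 < i then mu * v (i - 1) else 0)
        + (1 - beta - lam - (if 0 < i then mu else 0)) * v i + lam * v (i + 1))|
      ≤ (1 - beta) * ζ * D * ζ ^ i := by
  have hD : 0 ≤ D := by simpa using (abs_nonneg _).trans (h 0)
  have mono : ∀ j, j ≤ i + 1 → |u j - v j| ≤ D * ζ ^ (i + 1) := fun j hj =>
    (h j).trans (by gcongr)
  have bound : ∀ c j, 0 ≤ c → j ≤ i + 1 →
      c * (u j - v j) ≤ c * (D * ζ ^ (i + 1)) ∧ -(c * (D * ζ ^ (i + 1))) ≤ c * (u j - v j) := by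
    intro c j hc hj
    obtain ⟨h1, h2⟩ := abs_le.mp (mono j hj)
    exact ⟨mul_le_mul_of_nonneg_left h2 hc, by
      simpa using mul_le_mul_of_nonneg_left h1 hc⟩
  have hpow : (1 - beta) * ζ * D * ζ ^ i = (1 - beta) * (D * ζ ^ (i + 1)) := by ring
  rw [hpow]
  have hup := bound lam (i + 1) hlam le_rfl
  by_cases hi : 0 < i
  · have hdown := bound mu (i - 1) hmu (by omega)
    have hstay := bound (1 - beta - lam - mu) i (by linarith) (by omega)
    simp only [if_pos hi]
    rw [abs_le]
    constructor <;> linarith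
  · have hstay := bound (1 - beta - lam) i (by linarith) (by omega)
    simp only [if_neg hi]
    rw [abs_le]
    constructor <;> linarith

/-- Uniqueness of the `ζ`-weighted-bounded solution of the `β`-discounted optimality
equation associated with the control period. Here `1_{i>0}` is encoded with `if`
and `i - 1` is `ℕ`-subtraction. -/
theorem stmt15
    (lam mu1 mu2 beta : ℝ)
    (hlam : 0 < lam) (hmu1 : 0 < mu1) (hmu12 : mu1 < mu2) (hbeta : 0 < beta)
    (hsum : lam + mu1 + mu2 + beta = 1)
    (ζ : ℝ) (hζ1 : 1 < ζ) (hζ2 : ζ < 1 / (1 - beta))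
    (R1 R2 : ℕ → ℝ) (u1 u2 : ℕ → ℝ)
    (heq1 : ∀ i : ℕ, u1 i =
      min (R1 i + (if 0 < i then mu1 * u1 (i - 1) else 0)
          + (1 - beta - lam - (if 0 < i then mu1 else 0)) * u1 i + lam * u1 (i + 1))
        (R2 i + (if 0 < i then mu2 * u1 (i - 1) else 0)
          + (1 - beta - lam - (if 0 < i then mu2 else 0)) * u1 i + lam * u1 (i + 1)))
    (heq2 : ∀ i : ℕ, u2 i =
      min (R1 i + (if 0 < i then mu1 * u2 (i - 1) else 0)
          + (1 - beta - lam - (if 0 < i then mu1 else 0)) * u2 i + lam * u2 (i + 1))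
        (R2 i + (if 0 < i then mu2 * u2 (i - 1) else 0)
          + (1 - beta - lam - (if 0 < i then mu2 else 0)) * u2 i + lam * u2 (i + 1)))
    (hb1 : ∃ B : ℝ, ∀ i : ℕ, |u1 i| ≤ B * ζ ^ i)
    (hb2 : ∃ B : ℝ, ∀ i : ℕ, |u2 i| ≤ B * ζ ^ i) :
    u1 = u2 := by
  obtain ⟨B1, hB1⟩ := hb1
  obtain ⟨B2, hB2⟩ := hb2
  have hbeta1 : 0 < 1 - beta := by linarith
  have hc0 : 0 ≤ (1 - beta) * ζ := by positivity
  have hc1 : (1 - beta) * ζ < 1 := by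
    rwa [lt_div_iff₀ hbeta1, mul_comm] at hζ2
  have key : ∀ n i : ℕ, |u1 i - u2 i| ≤ ((1 - beta) * ζ) ^ n * (B1 + B2) * ζ ^ i := by
    intro n
    induction n with
    | zero =>
      intro i
      have := abs_sub (u1 i) (u2 i)
      linarith [hB1 i, hB2 i]
    | succ n ih =>
      intro i
      rw [heq1 i, heq2 i, pow_succ', mul_assoc ((1 - beta) * ζ)]
      exact (abs_min_sub_min_le_max _ _ _ _).trans (max_le
        (abs_birthDeath_sub_le hlam.le hmu1.le (by linarith) hζ1.le ih _ i)
        (abs_birthDeath_sub_le hlam.le (by linarith) (by linarith) hζ1.le ih _ i))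
  funext i
  have hlim : Filter.Tendsto (fun n : ℕ => ((1 - beta) * ζ) ^ n * (B1 + B2) * ζ ^ i)
      Filter.atTop (nhds 0) := by
    simpa using ((tendsto_pow_atTop_nhds_zero_of_lt_one hc0 hc1).mul_const
      (B1 + B2)).mul_const (ζ ^ i)
  have h0 : |u1 i - u2 i| ≤ 0 := ge_of_tendsto' hlim fun n => key n i
  exact sub_eq_zero.mp (abs_nonpos_iff.mp h0)
end

section
/- Geometric convergence of taboo value iteration to an M-bounded solution of the average-cost optimality equation: let ζ > 1, set M(i,0) = ζ^i/2 and M(i,1) = ζ^i, and suppose η ∈ [0,1) is such that ∑_{y ≠ (0,0)} p^a(x,y)·M(y) ≤ η·M(x) for every action a ∈ {μ1, μ2} and every state x ∈ ℕ × {0,1}. Let g ∈ ℝ and u > 0 be such that |c_a + h(i) − g| ≤ u·M(i,1) for a ∈ {μ1, μ2} and all i, and |cμ + h(i) − g| ≤ u·M(i,0) for all i, where c_{μ1} = 0 and c_{μ2} = c2. Define v₀ ≡ 0 and, recursively, v_{n+1}(i,1) = min_{a ∈ {μ1,μ2}} { c_a + h(i) − g + ∑_{y ≠ (0,0)} p^a((i,1),y)·v_n(y)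 } and v_{n+1}(i,0) = cμ + h(i) − g + ∑_{y ≠ (0,0)} p^a((i,0),y)·v_n(y). Suppose H : ℕ × {0,1} → ℝ satisfies H(i,1) = min_{a ∈ {μ1,μ2}} { c_a + h(i) − g + ∑_{y ≠ (0,0)} p^a((i,1),y)·H(y) }, H(i,0) = cμ + h(i) − g + ∑_{y ≠ (0,0)} p^a((i,0),y)·H(y), and |H(x)| ≤ (u/(1−η))·M(x) for all x. Then for every n ∈ ℕ and every state x, |H(x) − v_n(x)| ≤ (u·η^n/(1−η))·M(x). -/
/-- The taboo expectation `∑_{y ≠ (0,0)} p^a(x,y) f(y)`. -/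
noncomputable def tb (lam beta mu a : ℝ) (f : ℕ × Bool → ℝ) (x : ℕ × Bool) : ℝ :=
  ∑' y : ℕ × Bool, if y = ((0 : ℕ), false) then 0 else trP lam beta mu a x y * f y

/-- Taboo value iteration: `v₀ ≡ 0` and
`v_{n+1}(i,1) = min_{a ∈ {μ1,μ2}} { c_a + h(i) − g + ∑_{y ≠ (0,0)} p^a((i,1),y) v_n(y) }`
(with `c_{μ1} = 0`, `c_{μ2} = c2`), and
`v_{n+1}(i,0) = cμ + h(i) − g + ∑_{y ≠ (0,0)} p((i,0),y) v_n(y)`. -/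
noncomputable def vIter (lam mu1 mu2 beta c2 cmu mu g : ℝ) (h : ℕ → ℝ) :
    ℕ → ℕ × Bool → ℝ
  | 0 => fun _ => 0
  | n + 1 => fun x =>
      match x with
      | (i, true) =>
          min (h i - g + tb lam beta mu mu1 (vIter lam mu1 mu2 beta c2 cmu mu g h n) (i, true))
            (c2 + h i - g + tb lam beta mu mu2 (vIter lam mu1 mu2 beta c2 cmu mu g h n) (i, true))
      | (i, false) =>
          cmu + h i - g + tb lam beta mu mu1 (vIter lam mu1 mu2 beta c2 cmu mu g h n) (i, false)

/-- Transition probabilities are nonnegative. -/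
lemma trP_nonneg {lam beta mu a : ℝ} (hlam : 0 ≤ lam) (hbeta : 0 ≤ beta) (hmu : 0 ≤ mu)
    (ha : 0 ≤ a) (h1 : lam + beta + a ≤ 1) (h0 : lam + mu ≤ 1) (x y : ℕ × Bool) :
    0 ≤ trP lam beta mu a x y := by
  obtain ⟨i, _ | _⟩ := x <;> obtain ⟨j, _ | _⟩ := y <;> simp only [trP] <;>
    (try split_ifs) <;> linarith

/-- Jumps go up by at most one level. -/
lemma trP_eq_zero_of_lt (lam beta mu a : ℝ) {x y : ℕ × Bool} (h : x.1 + 1 < y.1) :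
    trP lam beta mu a x y = 0 := by
  obtain ⟨i, _ | _⟩ := x <;> obtain ⟨j, _ | _⟩ := y <;> dsimp only at h <;>
    simp only [trP] <;> (try split_ifs) <;> first | rfl | omega

/-- The taboo expectation is a finite sum. -/
lemma tb_eq_sum (lam beta mu a : ℝ) (f : ℕ × Bool → ℝ) (x : ℕ × Bool) :
    tb lam beta mu a f x = ∑ y ∈ Finset.range (x.1 + 2) ×ˢ (Finset.univ : Finset Bool),
      if y = ((0 : ℕ), false) then 0 else trP lam beta mu a x y * f y := by
  refine tsum_eq_sum fun y hy => ?_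
  have hlt : x.1 + 1 < y.1 := by
    simp only [Finset.mem_product, Finset.mem_range, Finset.mem_univ, and_true] at hy
    omega
  simp [trP_eq_zero_of_lt lam beta mu a hlt]

/-- The taboo expectation contracts differences measured against a weight `w`
with drift factor `η`. -/
lemma abs_tb_sub_tb_le {lam beta mu a C η : ℝ} {w f f' : ℕ × Bool → ℝ} {x : ℕ × Bool}
    (hp : ∀ y, 0 ≤ trP lam beta mu a x y) (hC : 0 ≤ C)
    (hw : tb lam beta mu a w x ≤ η * w x) (hf : ∀ y, |f y - f' y| ≤ C * w y) :
    |tb lam beta mu a f x - tb lam beta mu a f' x| ≤ C * η * w x := by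
  calc |tb lam beta mu a f x - tb lam beta mu a f' x|
      ≤ C * tb lam beta mu a w x := by
        simp only [tb_eq_sum]
        rw [← Finset.sum_sub_distrib, Finset.mul_sum]
        refine (Finset.abs_sum_le_sum_abs _ _).trans (Finset.sum_le_sum fun y _ => ?_)
        split_ifs
        · simp
        · rw [← mul_sub, abs_mul, abs_of_nonneg (hp y)]
          calc _ ≤ trP lam beta mu a x y * (C * w y) :=
                mul_le_mul_of_nonneg_left (hf y) (hp y)
            _ = _ := by ring
    _ ≤ C * (η * w x) := mul_le_mul_of_nonneg_left hw hC
    _ = C * η * w x := by ring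


/-- Geometric convergence of taboo value iteration to an `M`-bounded solution of the
average-cost optimality equation. -/
theorem stmt16
    (lam mu1 mu2 beta c2 cmu mu : ℝ) (h : ℕ → ℝ)
    (hlam : 0 < lam) (hmu1 : 0 < mu1) (hmu12 : mu1 < mu2) (hbeta : 0 < beta)
    (hsum : lam + mu1 + mu2 + beta = 1) (hc2 : 0 < c2)
    (hmu : (mu = mu1 ∧ cmu = 0) ∨ (mu = mu2 ∧ cmu = c2)) (hstab : lam < mu)
    (hh0 : h 0 = 0) (hhnn : ∀ i : ℕ, 0 ≤ h i) (hhmono : ∀ i : ℕ, h i ≤ h (i + 1))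
    (hhconv : ∀ j : ℕ, 1 ≤ j → h j - h (j - 1) ≤ h (j + 1) - h j)
    (ζ : ℝ) (hζ : 1 < ζ)
    (η : ℝ) (hη0 : 0 ≤ η) (hη1 : η < 1)
    (hdrift : ∀ a : ℝ, (a = mu1 ∨ a = mu2) → ∀ x : ℕ × Bool,
      tb lam beta mu a (Mwt ζ) x ≤ η * Mwt ζ x)
    (g u : ℝ) (hu : 0 < u)
    (hcost1 : ∀ i : ℕ, |h i - g| ≤ u * Mwt ζ (i, true))
    (hcost2 : ∀ i : ℕ, |c2 + h i - g| ≤ u * Mwt ζ (i, true))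
    (hcost0 : ∀ i : ℕ, |cmu + h i - g| ≤ u * Mwt ζ (i, false))
    (H : ℕ × Bool → ℝ)
    (hHeq1 : ∀ i : ℕ, H (i, true) =
      min (h i - g + tb lam beta mu mu1 H (i, true))
        (c2 + h i - g + tb lam beta mu mu2 H (i, true)))
    (hHeq0 : ∀ i : ℕ, H (i, false) = cmu + h i - g + tb lam beta mu mu1 H (i, false))
    (hHb : ∀ x : ℕ × Bool, |H x| ≤ (u / (1 - η)) * Mwt ζ x) :
    ∀ (n : ℕ) (x : ℕ × Bool),
      |H x - vIter lam mu1 mu2 beta c2 cmu mu g h n x| ≤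
        (u * η ^ n / (1 - η)) * Mwt ζ x := by
  have hmu0 : 0 ≤ mu := (hlam.trans hstab).le
  have hmule : lam + mu ≤ 1 := by rcases hmu with ⟨rfl, _⟩ | ⟨rfl, _⟩ <;> linarith
  intro n
  induction n with
  | zero => simpa [vIter] using hHb
  | succ n ih =>
    have hC : 0 ≤ u * η ^ n / (1 - η) :=
      div_nonneg (mul_nonneg hu.le (pow_nonneg hη0 n)) (sub_nonneg.2 hη1.le)
    have key : ∀ a : ℝ, (a = mu1 ∨ a = mu2) → ∀ x : ℕ × Bool,
        |tb lam beta mu a H x -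
          tb lam beta mu a (vIter lam mu1 mu2 beta c2 cmu mu g h n) x| ≤
          (u * η ^ (n + 1) / (1 - η)) * Mwt ζ x := by
      intro a ha x
      have hp : ∀ y, 0 ≤ trP lam beta mu a x y :=
        trP_nonneg hlam.le hbeta.le hmu0 (by rcases ha with rfl | rfl <;> linarith)
          (by rcases ha with rfl | rfl <;> linarith) hmule x
      convert abs_tb_sub_tb_le hp hC (hdrift a ha x) ih using 2
      ring
    rintro ⟨i, _ | _⟩
    · rw [hHeq0, vIter, add_sub_add_left_eq_sub]
      exact key mu1 (Or.inl rfl) _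
    · rw [hHeq1, vIter]
      refine (abs_min_sub_min_le_max _ _ _ _).trans (max_le ?_ ?_) <;>
        rw [add_sub_add_left_eq_sub]
      · exact key mu1 (Or.inl rfl) _
      · exact key mu2 (Or.inr rfl) _
end

section
/- Closed-form relative value function for the fixed-rate M/M/1 queue with quadratic holding costs: let λ, μ, c, K be real numbers with 0 < λ < μ. Set g = c + K·λ·(μ+λ)/(μ−λ)² and H(i) = K·i·(i+1)·(μ + 5λ + 2i(μ−λ)) / (6(μ−λ)²) for i ∈ ℕ. Then for every i ∈ ℕ, writing (i−1)⁺ = max(i−1,0): g + H(i) = c + K·i² + μ·H((i−1)⁺) + (1 − λ − μ)·H(i) + λ·H(i+1). -/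
/-- Closed-form relative value function for the fixed-rate M/M/1 queue with quadratic
holding costs `h(i) = K·i²`: the pair `(g, H)` with `g = c + Kλ(μ+λ)/(μ−λ)²` and
`H(i) = K·i·(i+1)·(μ + 5λ + 2i(μ−λ))/(6(μ−λ)²)` solves the average-cost optimality
equation. Here `i - 1` is `ℕ`-subtraction, i.e. `(i−1)⁺`. -/
theorem stmt18
    (lam mu c K : ℝ) (hlam : 0 < lam) (hmu : lam < mu)
    (g : ℝ) (H : ℕ → ℝ)
    (hg : g = c + K * lam * (mu + lam) / (mu - lam) ^ 2)
    (hH : ∀ i : ℕ, H i = K * i * (i + 1) * (mu + 5 * lam + 2 * i * (mu - lam)) /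
      (6 * (mu - lam) ^ 2)) :
    ∀ i : ℕ, g + H i =
      c + K * i ^ 2 + mu * H (i - 1) + (1 - lam - mu) * H i + lam * H (i + 1) := by
  have hd : mu - lam ≠ 0 := sub_ne_zero.mpr hmu.ne'
  rintro (_ | n)
  · simp only [hg, hH, Nat.zero_sub]
    push_cast
    field_simp
    ring
  · simp only [hg, hH, Nat.add_sub_cancel]
    push_cast
    field_simp
    ring
end
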